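/- arXiv:1207.1789 — 4 statements merged into one kernel-verified Lean document; each statement's English description precedes it below -/
import Mathlib

section
/- Let C ≠ C_{n,3} be a 3-uniform clutter on [n] (n ≥ 4) with {1,2,3}, {1,2,4}, {1,3,4}, {2,3,4} ∈ C, and suppose no circuit of C other than {1,2,3} and {1,2,4} contains {1,2}. Let I = I(C̄) and J = I + (x_1x_2x_3, x_1x_2x_4). Then reg(I) = reg(J). -/
open MvPolynomial

noncomputable section

/-- A graded free resolution of the ideal `I` over the polynomial ring `K[xᵢ : i ∈ σ]`:
the `i`-th free module has rank `b i`, its `k`-th standard generator sits in degree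
`deg i k`; `aug` is the augmentation map onto `I` and `d i` are the differentials.
All maps are graded (matrix entries are homogeneous of the appropriate degrees) and the
complex is exact. -/
def IsGradedFreeResolution {sig K : Type*} [Field K]
    (I : Ideal (MvPolynomial sig K)) (b : ℕ → ℕ) (deg : (i : ℕ) → Fin (b i) → ℕ)
    (aug : (Fin (b 0) → MvPolynomial sig K) →ₗ[MvPolynomial sig K] MvPolynomial sig K)
    (d : (i : ℕ) → ((Fin (b (i + 1)) → MvPolynomial sig K) →ₗ[MvPolynomial sig K]
      (Fin (b i) → MvPolynomial sig K))) : Prop :=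
  LinearMap.range aug = I ∧
  (∀ k, (aug (Pi.single k 1)).IsHomogeneous (deg 0 k)) ∧
  (∀ i k l, (d i) (Pi.single k 1) l = 0 ∨
    ∃ e, deg i l + e = deg (i + 1) k ∧ ((d i) (Pi.single k 1) l).IsHomogeneous e) ∧
  LinearMap.ker aug = LinearMap.range (d 0) ∧
  (∀ i, LinearMap.ker (d i) = LinearMap.range (d (i + 1)))

/-- `I` has a `q`-linear resolution: `I` has a graded free resolution in which the `i`-th
free module is generated entirely in degree `q + i`.  (Equivalently, `I` is generated in
degree `q` and `β_{i,j}(I) = 0` whenever `j ≠ i + q`.) -/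
def HasLinearResolution {sig K : Type*} [Field K] (q : ℕ)
    (I : Ideal (MvPolynomial sig K)) : Prop :=
  ∃ b deg aug d, IsGradedFreeResolution I b deg aug d ∧ ∀ i k, deg i k = q + i

/-- The Castelnuovo–Mumford regularity of `I`: the least `r` admitting a graded free
resolution of `I` whose `i`-th free module is generated in degrees `≤ r + i`.
(Equivalently, `reg I = sup { j - i : β_{i,j}(I) ≠ 0 }`.) -/
noncomputable def idealReg {sig K : Type*} [Field K] (I : Ideal (MvPolynomial sig K)) : ℕ :=
  sInf {r : ℕ | ∃ b deg aug d, IsGradedFreeResolution I b deg aug d ∧ ∀ i k, deg i k ≤ r + i}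

/-- The circuit ideal of a clutter `C` on `[n]`: the ideal generated by the square-free
monomials `x_F = ∏_{i ∈ F} x_i` for the circuits `F ∈ C`. -/
noncomputable def circuitIdeal {n : ℕ} (K : Type*) [Field K]
    (C : Finset (Finset (Fin n))) : Ideal (MvPolynomial (Fin n) K) :=
  Ideal.span ((fun F => ∏ i ∈ F, (MvPolynomial.X i : MvPolynomial (Fin n) K)) '' ↑C)

/-- The complement of a `d`-uniform clutter `C` on `[n]` inside the maximal `d`-uniform
clutter `C_{n,d}` of all `d`-subsets of `[n]`. -/
def clutterCompl {n : ℕ} (d : ℕ) (C : Finset (Finset (Fin n))) : Finset (Finset (Fin n)) :=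
  Finset.powersetCard d (Finset.univ : Finset (Fin n)) \ C

universe u

/-- A module over `K[xᵢ : i ∈ σ]` with a family of homogeneous pieces on which homogeneous
polynomials act compatibly with degrees. -/
structure GrMod (σ : Type) (K : Type u) [Field K] where
  /-- the underlying module -/
  carrier : Type u
  [addCommGroup : AddCommGroup carrier]
  [module : Module (MvPolynomial σ K) carrier]
  /-- the elements of a given degree -/
  piece : ℕ → AddSubgroup carrier
  smul_mem : ∀ {e d : ℕ} {s : MvPolynomial σ K} {x : carrier},
    s.IsHomogeneous e → x ∈ piece d → s • x ∈ piece (d + e)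

attribute [instance] GrMod.addCommGroup GrMod.module

namespace GrMod

variable {σ : Type} {K : Type u} [Field K]

theorem isHomogeneous_iff_degree {p : MvPolynomial σ K} {e : ℕ} :
    p.IsHomogeneous e ↔ ∀ m, coeff m p ≠ 0 → m.degree = e := by
  simp only [IsHomogeneous, IsWeightedHomogeneous, Finsupp.degree_eq_weight_one]
  rfl

/-- The degree `d` part of the free module with generators in degrees `w`. -/
def freePiece {b : ℕ} (w : Fin b → ℕ) (d : ℕ) : AddSubgroup (Fin b → MvPolynomial σ K) where
  carrier := {v | ∀ k m, coeff m (v k) ≠ 0 → w k + m.degree = d}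
  zero_mem' := by simp
  add_mem' := by
    intro u v hu hv k m h
    by_cases h1 : coeff m (u k) = 0
    · exact hv k m (by simpa [h1] using h)
    · exact hu k m h1
  neg_mem' := by
    intro u hu k m h
    exact hu k m (by simpa using h)

theorem mem_freePiece {b : ℕ} {w : Fin b → ℕ} {d : ℕ} {v : Fin b → MvPolynomial σ K} :
    v ∈ freePiece w d ↔ ∀ k m, coeff m (v k) ≠ 0 → w k + m.degree = d := Iff.rfl

theorem mem_freePiece_iff {b : ℕ} {w : Fin b → ℕ} {d : ℕ} {v : Fin b → MvPolynomial σ K} :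
    v ∈ freePiece w d ↔ ∀ k, v k = 0 ∨ ∃ e, w k + e = d ∧ (v k).IsHomogeneous e := by
  rw [mem_freePiece]
  refine forall_congr' fun k => ⟨fun h => ?_, ?_⟩
  · by_cases h0 : v k = 0
    · exact .inl h0
    · obtain ⟨m, hm⟩ := exists_coeff_ne_zero h0
      refine .inr ⟨m.degree, h m hm, isHomogeneous_iff_degree.2 fun m' hm' => ?_⟩
      have := h m hm
      have := h m' hm'
      omega
  · rintro (h | ⟨e, he, h⟩) m hm
    · simp [h] at hm
    · rw [isHomogeneous_iff_degree.1 h m hm, he]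

theorem smul_mem_freePiece {b : ℕ} {w : Fin b → ℕ} {e d : ℕ} {s : MvPolynomial σ K}
    {v : Fin b → MvPolynomial σ K} (hs : s.IsHomogeneous e) (hv : v ∈ freePiece w d) :
    s • v ∈ freePiece w (d + e) := by
  rw [mem_freePiece_iff] at hv ⊢
  intro k
  rcases hv k with h | ⟨e', he', h⟩
  · simp [h]
  · exact .inr ⟨e + e', by omega, hs.mul h⟩

/-- A submodule of a graded free module. -/
abbrev ofSubmodule {b : ℕ} (w : Fin b → ℕ)
    (N : Submodule (MvPolynomial σ K) (Fin b → MvPolynomial σ K)) : GrMod σ K where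
  carrier := N
  piece d := (freePiece w d).comap N.subtype.toAddMonoidHom
  smul_mem hs hx := smul_mem_freePiece hs hx

/-- An ideal of the polynomial ring. -/
abbrev ofIdeal (I : Ideal (MvPolynomial σ K)) : GrMod σ K where
  carrier := I
  piece d := (homogeneousSubmodule σ K d).toAddSubgroup.comap I.subtype.toAddMonoidHom
  smul_mem {e d s x} hs hx := by
    have : (s * x.1).IsHomogeneous (e + d) := IsHomogeneous.mul hs hx
    rw [add_comm] at this
    exact this

/-- The direct sum of two graded modules. -/
abbrev prod (A B : GrMod σ K) : GrMod σ K where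
  carrier := A.carrier × B.carrier
  piece d := (A.piece d).prod (B.piece d)
  smul_mem hs hx := ⟨A.smul_mem hs hx.1, B.smul_mem hs hx.2⟩

/-- The kernel of the map from a graded free module given by the elements `g`. -/
abbrev syz {M : GrMod σ K} {b : ℕ} (w : Fin b → ℕ) (g : Fin b → M.carrier) : GrMod σ K :=
  ofSubmodule w (LinearMap.ker (Fintype.linearCombination (MvPolynomial σ K) g))

/-- The elements `g`, of degrees `w`, generate `M`, degree by degree. -/
structure Generates (M : GrMod σ K) {b : ℕ} (w : Fin b → ℕ) (g : Fin b → M.carrier) : Prop where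
  mem : ∀ k, g k ∈ M.piece (w k)
  surj : ∀ x, ∃ v, Fintype.linearCombination (MvPolynomial σ K) g v = x
  surj_piece : ∀ d, ∀ x ∈ M.piece d,
    ∃ v ∈ freePiece w d, Fintype.linearCombination (MvPolynomial σ K) g v = x

/-- `M` is generated in degrees at most `r`, with syzygy module satisfying `P (r + 1)`. -/
def Step (P : ℕ → GrMod σ K → Prop) (r : ℕ) (M : GrMod σ K) : Prop :=
  ∃ (b : ℕ) (w : Fin b → ℕ) (g : Fin b → M.carrier),
    (∀ k, w k ≤ r) ∧ M.Generates w g ∧ P (r + 1) (syz w g)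

/-- `M` has a graded free resolution whose `i`-th module is generated in degrees at most
`r + i`. -/
def RegLE (r : ℕ) (M : GrMod σ K) : Prop :=
  ∃ P : ℕ → GrMod σ K → Prop, (∀ s N, P s N → Step P s N) ∧ P r M

theorem Step.mono {P Q : ℕ → GrMod σ K → Prop} (h : ∀ s N, P s N → Q s N) {r : ℕ} {M : GrMod σ K}
    (hM : Step P r M) : Step Q r M := by
  obtain ⟨b, w, g, h1, h2, h3⟩ := hM
  exact ⟨b, w, g, h1, h2, h _ _ h3⟩

theorem RegLE.step {r : ℕ} {M : GrMod σ K} (h : RegLE r M) : Step RegLE r M := by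
  obtain ⟨P, hP, hM⟩ := h
  exact (hP _ _ hM).mono fun s N hN => ⟨P, hP, hN⟩

theorem RegLE.of_step {r : ℕ} {M : GrMod σ K} (h : Step RegLE r M) : RegLE r M :=
  ⟨Step RegLE, fun _ _ hN => hN.mono fun _ _ => RegLE.step, h⟩

theorem RegLE.mono {r s : ℕ} {M : GrMod σ K} (h : RegLE r M) (hrs : r ≤ s) : RegLE s M := by
  refine ⟨fun s N => ∃ r ≤ s, RegLE r N, ?_, r, hrs, h⟩
  rintro s N ⟨r, hr, hN⟩
  obtain ⟨b, w, g, h1, h2, h3⟩ := hN.step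
  exact ⟨b, w, g, fun k => (h1 k).trans hr, h2, r + 1, by omega, h3⟩

theorem regLE_of_subsingleton (r : ℕ) (M : GrMod σ K) [hM : Subsingleton M.carrier] :
    RegLE r M := by
  refine ⟨fun _ N => Subsingleton N.carrier, ?_, hM⟩
  intro s N hN
  exact ⟨0, Fin.elim0, Fin.elim0, fun k => k.elim0,
    ⟨fun k => k.elim0, fun x => ⟨0, Subsingleton.elim _ _⟩,
      fun d x _ => ⟨0, zero_mem _, Subsingleton.elim _ _⟩⟩, inferInstance⟩

/-- A short exact sequence of graded modules, exact in every degree. -/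
structure ShortExact {A B C : GrMod σ K} (f : A.carrier →ₗ[MvPolynomial σ K] B.carrier)
    (p : B.carrier →ₗ[MvPolynomial σ K] C.carrier) : Prop where
  inj : Function.Injective f
  surj : Function.Surjective p
  exact : ∀ x, p x = 0 ↔ ∃ a, f a = x
  mem_left : ∀ d a, f a ∈ B.piece d ↔ a ∈ A.piece d
  mem_right : ∀ d x, x ∈ B.piece d → p x ∈ C.piece d
  surj_piece : ∀ d, ∀ y ∈ C.piece d, ∃ x ∈ B.piece d, p x = y

theorem linearCombination_mem {M : GrMod σ K} {b : ℕ} {w : Fin b → ℕ} {g : Fin b → M.carrier}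
    (hg : ∀ k, g k ∈ M.piece (w k)) {d : ℕ} {v : Fin b → MvPolynomial σ K}
    (hv : v ∈ freePiece w d) :
    Fintype.linearCombination (MvPolynomial σ K) g v ∈ M.piece d := by
  rw [Fintype.linearCombination_apply]
  refine AddSubgroup.sum_mem _ fun k _ => ?_
  rcases mem_freePiece_iff.1 hv k with h | ⟨e, he, h⟩
  · simp [h, zero_mem]
  · rw [← he]
    exact M.smul_mem h (hg k)

theorem linearCombination_append {M : GrMod σ K} {b c : ℕ} (g : Fin b → M.carrier)
    (h : Fin c → M.carrier) (v : Fin (b + c) → MvPolynomial σ K) :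
    Fintype.linearCombination (MvPolynomial σ K) (Fin.append g h) v =
      Fintype.linearCombination (MvPolynomial σ K) g (fun k => v (Fin.castAdd c k)) +
      Fintype.linearCombination (MvPolynomial σ K) h (fun k => v (Fin.natAdd b k)) := by
  simp [Fintype.linearCombination_apply, Fin.sum_univ_add]

theorem mem_freePiece_append {b c : ℕ} {w : Fin b → ℕ} {w' : Fin c → ℕ} {d : ℕ}
    {v : Fin (b + c) → MvPolynomial σ K} :
    v ∈ freePiece (Fin.append w w') d ↔
      (fun k => v (Fin.castAdd c k)) ∈ freePiece w d ∧
      (fun k => v (Fin.natAdd b k)) ∈ freePiece w' d := by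
  simp only [mem_freePiece]
  constructor
  · intro h
    exact ⟨fun k m hm => by simpa using h _ m hm, fun k m hm => by simpa using h _ m hm⟩
  · rintro ⟨h1, h2⟩ k
    refine Fin.addCases (fun k => ?_) (fun k => ?_) k
    · simpa using h1 k
    · simpa using h2 k

theorem map_linearCombination {A B : GrMod σ K} (f : A.carrier →ₗ[MvPolynomial σ K] B.carrier)
    {b : ℕ} (g : Fin b → A.carrier) (v : Fin b → MvPolynomial σ K) :
    Fintype.linearCombination (MvPolynomial σ K) (fun k => f (g k)) v =
      f (Fintype.linearCombination (MvPolynomial σ K) g v) := by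
  simp [Fintype.linearCombination_apply]

/-- Extensions of modules of regularity at most `r` have regularity at most `r`. -/
theorem RegLE.middle {r : ℕ} {A B C : GrMod σ K}
    {f : A.carrier →ₗ[MvPolynomial σ K] B.carrier} {p : B.carrier →ₗ[MvPolynomial σ K] C.carrier}
    (hE : ShortExact f p) (hA : RegLE r A) (hC : RegLE r C) : RegLE r B := by
  refine ⟨fun s N => ∃ (A C : GrMod σ K) (f : A.carrier →ₗ[MvPolynomial σ K] N.carrier)
    (p : N.carrier →ₗ[MvPolynomial σ K] C.carrier), ShortExact f p ∧ RegLE s A ∧ RegLE s C,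
    ?_, A, C, f, p, hE, hA, hC⟩
  clear hE hA hC p f A B C
  rintro s B ⟨A, C, f, p, hE, hA, hC⟩
  obtain ⟨b, w, g, hw, hg, hΩA⟩ := hA.step
  obtain ⟨c, w', g', hw', hg', hΩC⟩ := hC.step
  choose h hmem hph using fun k => hE.surj_piece _ _ (hg'.mem k)
  have hph' : ∀ v, p (Fintype.linearCombination (MvPolynomial σ K) h v) =
      Fintype.linearCombination (MvPolynomial σ K) g' v := by
    intro v
    rw [← map_linearCombination]
    simp [hph]
  have hpf : ∀ a, p (f a) = 0 := fun a => (hE.exact _).2 ⟨a, rfl⟩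
  have hgen : ∀ v, Fintype.linearCombination (MvPolynomial σ K)
      (Fin.append (fun k => f (g k)) h) v =
      f (Fintype.linearCombination (MvPolynomial σ K) g (fun k => v (Fin.castAdd c k))) +
      Fintype.linearCombination (MvPolynomial σ K) h (fun k => v (Fin.natAdd b k)) := by
    intro v
    rw [linearCombination_append, map_linearCombination]
  refine ⟨b + c, Fin.append w w', Fin.append (fun k => f (g k)) h, ?_, ⟨?_, ?_, ?_⟩, ?_⟩
  · intro k
    refine Fin.addCases (fun k => ?_) (fun k => ?_) k
    · simpa using hw k
    · simpa using hw' k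
  · intro k
    refine Fin.addCases (fun k => ?_) (fun k => ?_) k
    · simpa using (hE.mem_left _ _).2 (hg.mem k)
    · simpa using hmem k
  · intro x
    obtain ⟨v', hv'⟩ := hg'.surj (p x)
    obtain ⟨a, ha⟩ := (hE.exact (x - Fintype.linearCombination (MvPolynomial σ K) h v')).1
      (by rw [map_sub, hph', hv', sub_self])
    obtain ⟨v, hv⟩ := hg.surj a
    refine ⟨Fin.append v v', ?_⟩
    rw [hgen]
    simp [hv, ha]
  · intro d x hx
    obtain ⟨v', hv'd, hv'⟩ := hg'.surj_piece d _ (hE.mem_right _ _ hx)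
    obtain ⟨a, ha⟩ := (hE.exact (x - Fintype.linearCombination (MvPolynomial σ K) h v')).1
      (by rw [map_sub, hph', hv', sub_self])
    have had : a ∈ A.piece d := by
      rw [← hE.mem_left, ha]
      exact sub_mem hx (linearCombination_mem hmem hv'd)
    obtain ⟨v, hvd, hv⟩ := hg.surj_piece d a had
    refine ⟨Fin.append v v', mem_freePiece_append.2 ⟨by simpa using hvd, by simpa using hv'd⟩, ?_⟩
    rw [hgen]
    simp [hv, ha]
  · let F : (Fin b → MvPolynomial σ K) →ₗ[MvPolynomial σ K] (Fin (b + c) → MvPolynomial σ K) :=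
      { toFun := fun v => Fin.append v 0
        map_add' := fun u v => by
          ext1 k
          refine Fin.addCases (fun k => ?_) (fun k => ?_) k <;> simp
        map_smul' := fun a v => by
          ext1 k
          refine Fin.addCases (fun k => ?_) (fun k => ?_) k <;> simp }
    let G : (Fin (b + c) → MvPolynomial σ K) →ₗ[MvPolynomial σ K] (Fin c → MvPolynomial σ K) :=
      LinearMap.funLeft _ _ (Fin.natAdd b)
    have hF : ∀ v ∈ LinearMap.ker (Fintype.linearCombination (MvPolynomial σ K) g),
        F v ∈ LinearMap.ker (Fintype.linearCombination (MvPolynomial σ K)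
          (Fin.append (fun k => f (g k)) h)) := by
      intro v hv
      rw [LinearMap.mem_ker] at hv ⊢
      rw [hgen]
      have : (fun k => F v (Fin.natAdd b k)) = 0 := by ext1 k; simp [F]
      rw [this]
      simp [F, hv]
    have hG : ∀ v ∈ LinearMap.ker (Fintype.linearCombination (MvPolynomial σ K)
          (Fin.append (fun k => f (g k)) h)),
        G v ∈ LinearMap.ker (Fintype.linearCombination (MvPolynomial σ K) g') := by
      intro v hv
      rw [LinearMap.mem_ker] at hv ⊢
      rw [hgen] at hv
      have := congrArg p hv
      rw [map_add, hpf, zero_add, hph', map_zero] at this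
      exact this
    refine ⟨syz w g, syz w' g', F.restrict hF, G.restrict hG, ⟨?_, ?_, ?_, ?_, ?_, ?_⟩, hΩA, hΩC⟩
    · rintro ⟨u, hu⟩ ⟨v, hv⟩ huv
      have : F u = F v := congrArg Subtype.val huv
      refine Subtype.ext (funext fun k => ?_)
      simpa [F] using congrFun this (Fin.castAdd c k)
    · rintro ⟨v', hv'⟩
      obtain ⟨a, ha⟩ := (hE.exact (Fintype.linearCombination (MvPolynomial σ K) h v')).1
        (by rw [hph']; exact hv')
      obtain ⟨v, hv⟩ := hg.surj (-a)
      refine ⟨⟨Fin.append v v', ?_⟩, Subtype.ext (funext fun k => ?_)⟩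
      · rw [LinearMap.mem_ker, hgen]
        simp [hv, ha]
      · simp [G, LinearMap.funLeft]
    · rintro ⟨v, hv⟩
      constructor
      · intro h0
        have h0' : G v = 0 := congrArg Subtype.val h0
        have h0'' : (fun k => v (Fin.natAdd b k)) = 0 := h0'
        refine ⟨⟨fun k => v (Fin.castAdd c k), ?_⟩, Subtype.ext (funext fun k => ?_)⟩
        · rw [LinearMap.mem_ker] at hv ⊢
          rw [hgen, h0'', map_zero, add_zero] at hv
          exact hE.inj (by rw [hv, map_zero])
        · refine Fin.addCases (fun k => ?_) (fun k => ?_) k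
          · simp [F]
          · simpa [F] using (congrFun h0'' k).symm
      · rintro ⟨⟨u, hu⟩, huv⟩
        have : F u = v := congrArg Subtype.val huv
        refine Subtype.ext (funext fun k => ?_)
        simp [← this, G, F, LinearMap.funLeft]
    · rintro d ⟨v, hv⟩
      change F v ∈ freePiece _ d ↔ v ∈ freePiece _ d
      have h0 : (fun k => F v (Fin.natAdd b k)) = 0 := by ext1 k; simp [F]
      rw [mem_freePiece_append, h0]
      simp [F, zero_mem]
    · rintro d ⟨v, hv⟩ hd
      exact (mem_freePiece_append.1 hd).2
    · rintro d ⟨v', hv'⟩ hd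
      obtain ⟨a, ha⟩ := (hE.exact (Fintype.linearCombination (MvPolynomial σ K) h v')).1
        (by rw [hph']; exact hv')
      have had : a ∈ A.piece d := by
        rw [← hE.mem_left, ha]
        exact linearCombination_mem hmem hd
      obtain ⟨v, hvd, hv⟩ := hg.surj_piece d (-a) (neg_mem had)
      refine ⟨⟨Fin.append v v', ?_⟩, ?_, Subtype.ext (funext fun k => ?_)⟩
      · rw [LinearMap.mem_ker, hgen]
        simp [hv, ha]
      · have hd' : v' ∈ freePiece w' d := hd
        exact mem_freePiece_append.2 ⟨by simpa using hvd, by simpa using hd'⟩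
      · simp [G, LinearMap.funLeft]

/-- The mapping cone bound on the regularity of a quotient. -/
theorem RegLE.right {r : ℕ} {A B C : GrMod σ K}
    {f : A.carrier →ₗ[MvPolynomial σ K] B.carrier} {p : B.carrier →ₗ[MvPolynomial σ K] C.carrier}
    (hE : ShortExact f p) (hA : RegLE (r + 1) A) (hB : RegLE r B) : RegLE r C := by
  obtain ⟨b, w, g, hw, hg, hΩB⟩ := hB.step
  have hgen := map_linearCombination p g
  refine RegLE.of_step ⟨b, w, fun k => p (g k), hw, ⟨?_, ?_, ?_⟩, ?_⟩
  · exact fun k => hE.mem_right _ _ (hg.mem k)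
  · intro y
    obtain ⟨x, rfl⟩ := hE.surj y
    obtain ⟨v, rfl⟩ := hg.surj x
    exact ⟨v, hgen v⟩
  · intro d y hy
    obtain ⟨x, hx, rfl⟩ := hE.surj_piece d y hy
    obtain ⟨v, hv, rfl⟩ := hg.surj_piece d x hx
    exact ⟨v, hv, hgen v⟩
  · have hle : LinearMap.ker (Fintype.linearCombination (MvPolynomial σ K) g) ≤
        LinearMap.ker (Fintype.linearCombination (MvPolynomial σ K) fun k => p (g k)) := by
      intro v hv
      rw [LinearMap.mem_ker] at hv ⊢
      rw [hgen, hv, map_zero]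
    have hr : ∀ v : LinearMap.ker (Fintype.linearCombination (MvPolynomial σ K) fun k => p (g k)),
        Fintype.linearCombination (MvPolynomial σ K) g v.1 ∈ LinearMap.range f := by
      rintro ⟨v, hv⟩
      rw [LinearMap.mem_ker, hgen] at hv
      exact (hE.exact _).1 hv
    let G : LinearMap.ker (Fintype.linearCombination (MvPolynomial σ K) fun k => p (g k))
        →ₗ[MvPolynomial σ K] A.carrier :=
      (LinearEquiv.ofInjective f hE.inj).symm.toLinearMap ∘ₗ
        ((Fintype.linearCombination (MvPolynomial σ K) g) ∘ₗ
          Submodule.subtype _).codRestrict (LinearMap.range f) hr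
    have hfG : ∀ v, f (G v) = Fintype.linearCombination (MvPolynomial σ K) g v.1 := by
      intro v
      exact congrArg Subtype.val ((LinearEquiv.ofInjective f hE.inj).apply_symm_apply
        (⟨Fintype.linearCombination (MvPolynomial σ K) g v.1, hr v⟩ : LinearMap.range f))
    refine RegLE.middle (A := syz w g) (C := A) (f := Submodule.inclusion hle) (p := G)
      ⟨?_, ?_, ?_, ?_, ?_, ?_⟩ hΩB hA
    · exact Submodule.inclusion_injective hle
    · intro a
      obtain ⟨v, hv⟩ := hg.surj (f a)
      refine ⟨⟨v, ?_⟩, hE.inj ?_⟩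
      · rw [LinearMap.mem_ker, hgen, hv]
        exact (hE.exact _).2 ⟨a, rfl⟩
      · rw [hfG, hv]
    · intro v
      constructor
      · intro h
        refine ⟨⟨v.1, ?_⟩, rfl⟩
        rw [LinearMap.mem_ker, ← hfG, h, map_zero]
      · rintro ⟨u, rfl⟩
        refine hE.inj ?_
        rw [hfG, map_zero]
        exact u.2
    · exact fun d a => Iff.rfl
    · intro d v hv
      rw [← hE.mem_left, hfG]
      exact linearCombination_mem hg.mem hv
    · intro d a ha
      obtain ⟨v, hvd, hv⟩ := hg.surj_piece d (f a) ((hE.mem_left _ _).2 ha)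
      refine ⟨⟨v, ?_⟩, hvd, hE.inj ?_⟩
      · rw [LinearMap.mem_ker, hgen, hv]
        exact (hE.exact _).2 ⟨a, rfl⟩
      · rw [hfG, hv]

theorem shortExact_prod (A B : GrMod σ K) :
    ShortExact (A := A) (B := prod A B) (C := B) (LinearMap.inl _ _ _) (LinearMap.snd _ _ _) where
  inj := LinearMap.inl_injective
  surj := LinearMap.snd_surjective
  exact x := ⟨fun h => ⟨x.1, Prod.ext rfl h.symm⟩, by rintro ⟨a, rfl⟩; rfl⟩
  mem_left d a := ⟨fun h => h.1, fun h => ⟨h, zero_mem _⟩⟩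
  mem_right d x h := h.2
  surj_piece d y h := ⟨(0, y), ⟨zero_mem _, h⟩, rfl⟩

theorem exists_shortExact_sup {I J L P : Ideal (MvPolynomial σ K)}
    (hI : ∀ x ∈ I, ∀ d, homogeneousComponent d x ∈ I)
    (hJ : ∀ x ∈ J, ∀ d, homogeneousComponent d x ∈ J) (hL : I ⊓ J = L) (hP : I ⊔ J = P) :
    ∃ f p, ShortExact (A := ofIdeal L) (B := prod (ofIdeal I) (ofIdeal J)) (C := ofIdeal P)
      f p := by
  subst hL hP
  refine ⟨(Submodule.inclusion inf_le_left).prod (-Submodule.inclusion inf_le_right),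
    (Submodule.inclusion le_sup_left).coprod (Submodule.inclusion le_sup_right),
    { inj := ?_, surj := ?_, exact := ?_, mem_left := ?_, mem_right := ?_, surj_piece := ?_ }⟩
  · exact fun a b h => Subtype.ext (congrArg (fun y => y.1.1) h)
  · rintro ⟨x, hx⟩
    obtain ⟨i, hi, j, hj, rfl⟩ := Submodule.mem_sup.1 hx
    exact ⟨(⟨i, hi⟩, ⟨j, hj⟩), rfl⟩
  · rintro ⟨⟨i, hi⟩, ⟨j, hj⟩⟩
    constructor
    · intro h
      have h' : i + j = 0 := congrArg Subtype.val h
      obtain rfl : j = -i := (neg_eq_of_add_eq_zero_right h').symm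
      exact ⟨⟨i, hi, by simpa using neg_mem hj⟩, rfl⟩
    · rintro ⟨a, ha⟩
      have h1 : a.1 = i := congrArg (fun y => y.1.1) ha
      have h2 : -a.1 = j := congrArg (fun y => y.2.1) ha
      refine Subtype.ext ?_
      change i + j = 0
      rw [← h1, ← h2, add_neg_cancel]
  · intro d a
    refine ⟨fun h => h.1, fun h => ⟨h, ?_⟩⟩
    exact (homogeneousSubmodule σ K d).toAddSubgroup.neg_mem h
  · rintro d x ⟨h1, h2⟩
    exact IsHomogeneous.add h1 h2
  · rintro d ⟨x, hx⟩ hd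
    obtain ⟨i, hi, j, hj, rfl⟩ := Submodule.mem_sup.1 hx
    refine ⟨(⟨homogeneousComponent d i, hI i hi d⟩, ⟨homogeneousComponent d j, hJ j hj d⟩),
      ⟨homogeneousComponent_isHomogeneous d i, homogeneousComponent_isHomogeneous d j⟩,
      Subtype.ext ?_⟩
    change homogeneousComponent d i + homogeneousComponent d j = i + j
    have hd' : i + j ∈ homogeneousSubmodule σ K d := hd
    rw [← map_add, homogeneousComponent_of_mem hd', if_pos rfl]

/-- The monomial ideal with exponents of generators in `A`. -/
def monoIdeal (K : Type u) [Field K] (A : Set (σ →₀ ℕ)) : Ideal (MvPolynomial σ K) :=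
  Ideal.span ((fun s => monomial s 1) '' A)

theorem mem_monoIdeal {A : Set (σ →₀ ℕ)} {x : MvPolynomial σ K} :
    x ∈ monoIdeal K A ↔ ∀ m, coeff m x ≠ 0 → ∃ s ∈ A, s ≤ m := by
  rw [monoIdeal, mem_ideal_span_monomial_image]
  simp only [mem_support_iff]

theorem homogeneousComponent_mem_monoIdeal {A : Set (σ →₀ ℕ)} (x : MvPolynomial σ K)
    (hx : x ∈ monoIdeal K A) (d : ℕ) : homogeneousComponent d x ∈ monoIdeal K A := by
  rw [mem_monoIdeal] at hx ⊢
  intro m hm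
  refine hx m fun h => hm ?_
  rw [coeff_homogeneousComponent, h, ite_self]

theorem monoIdeal_sup (A B : Set (σ →₀ ℕ)) :
    monoIdeal K A ⊔ monoIdeal K B = monoIdeal K (A ∪ B) := by
  rw [monoIdeal, monoIdeal, monoIdeal, Set.image_union, Ideal.span_union]

theorem monoIdeal_inf {A B C : Set (σ →₀ ℕ)}
    (h : ∀ m, (∃ s ∈ C, s ≤ m) ↔ (∃ s ∈ A, s ≤ m) ∧ ∃ s ∈ B, s ≤ m) :
    monoIdeal K A ⊓ monoIdeal K B = monoIdeal K C := by
  ext x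
  simp only [Submodule.mem_inf, mem_monoIdeal, h]
  exact ⟨fun hx m hm => ⟨hx.1 m hm, hx.2 m hm⟩, fun hx => ⟨fun m hm => (hx m hm).1,
    fun m hm => (hx m hm).2⟩⟩

theorem regLE_iff_of_sup {A B C D : Set (σ →₀ ℕ)} {r : ℕ} (hA : RegLE r (ofIdeal (monoIdeal K A)))
    (hC : RegLE r (ofIdeal (monoIdeal K C)))
    (hinf : ∀ m, (∃ s ∈ C, s ≤ m) ↔ (∃ s ∈ A, s ≤ m) ∧ ∃ s ∈ B, s ≤ m)
    (hsup : monoIdeal K A ⊔ monoIdeal K B = monoIdeal K D) :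
    RegLE r (ofIdeal (monoIdeal K B)) ↔ RegLE r (ofIdeal (monoIdeal K D)) := by
  obtain ⟨f, p, hE⟩ := exists_shortExact_sup (homogeneousComponent_mem_monoIdeal (K := K) (A := A))
    (homogeneousComponent_mem_monoIdeal (K := K) (A := B)) (monoIdeal_inf hinf) hsup
  have hP := shortExact_prod (ofIdeal (monoIdeal K A)) (ofIdeal (monoIdeal K B))
  exact ⟨fun hB => (hC.mono r.le_succ).right hE (.middle hP hA hB),
    fun hD => (hA.mono r.le_succ).right hP (.middle hE hC hD)⟩

theorem regLE_span_monomial (s : σ →₀ ℕ) : RegLE s.degree (ofIdeal (monoIdeal K {s})) := by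
  have hmem : (monomial s 1 : MvPolynomial σ K) ∈ monoIdeal K {s} :=
    Ideal.subset_span ⟨s, rfl, rfl⟩
  have hlin : ∀ v, (Fintype.linearCombination (MvPolynomial σ K)
      (fun _ : Fin 1 => (⟨monomial s 1, hmem⟩ : monoIdeal K {s})) v).1 = v 0 * monomial s 1 := by
    intro v
    simp [Fintype.linearCombination_apply]
  have hsurj : ∀ x ∈ monoIdeal K {s}, ∃ a, x = a * monomial s 1 := by
    intro x hx
    rw [monoIdeal, Set.image_singleton, Ideal.mem_span_singleton'] at hx
    obtain ⟨a, ha⟩ := hx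
    exact ⟨a, ha.symm⟩
  refine RegLE.of_step ⟨1, fun _ => s.degree, fun _ => ⟨monomial s 1, hmem⟩, fun _ => le_rfl,
    ⟨fun _ => ?_, ?_, ?_⟩, ?_⟩
  · exact isHomogeneous_monomial _ rfl
  · rintro ⟨x, hx⟩
    obtain ⟨a, rfl⟩ := hsurj x hx
    exact ⟨fun _ => a, Subtype.ext (hlin _)⟩
  · rintro d ⟨x, hx⟩ hd
    obtain ⟨a, rfl⟩ := hsurj x hx
    refine ⟨fun _ => a, fun k m hm => ?_, Subtype.ext (hlin _)⟩
    have := isHomogeneous_iff_degree.1 (show IsHomogeneous (a * monomial s 1) d from hd) (m + s)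
      (by rw [coeff_mul_monomial]; simpa using hm)
    rw [← this, map_add, add_comm]
  · refine @regLE_of_subsingleton _ _ _ _ _ ⟨?_⟩
    have h0 : ∀ v : LinearMap.ker (Fintype.linearCombination (MvPolynomial σ K)
      (fun _ : Fin 1 => (⟨monomial s 1, hmem⟩ : monoIdeal K {s}))), v = 0 := by
      rintro ⟨v, hv⟩
      have h := hlin v
      rw [LinearMap.mem_ker.1 hv] at h
      have h1 : (monomial s 1 : MvPolynomial σ K) ≠ 0 := by simp
      have h2 : v 0 = 0 := by
        rcases mul_eq_zero.1 h.symm with h | h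
        · exact h
        · exact absurd h h1
      refine Subtype.ext (funext fun k => ?_)
      rw [Subsingleton.elim k 0]
      exact h2
    intro u v
    rw [h0 u, h0 v]

theorem add_single_le_iff {s m : σ →₀ ℕ} {y : σ} :
    s + Finsupp.single y 1 ≤ m ↔ s ≤ m ∧ s y + 1 ≤ m y := by
  classical
  constructor
  · intro h
    exact ⟨le_trans le_self_add h, by simpa using h y⟩
  · rintro ⟨h1, h2⟩ i
    by_cases hi : i = y
    · subst hi; simpa using h2
    · simpa [Finsupp.single_apply, Ne.symm hi] using h1 i

/-- A monomial times an ideal of variables has a linear resolution. -/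
theorem regLE_monomial_mul_variables (T : Finset σ) (s : σ →₀ ℕ) :
    RegLE (s.degree + 1)
      (ofIdeal (monoIdeal K ((fun i => s + Finsupp.single i 1) '' (T : Set σ)))) := by
  classical
  induction T using Finset.induction_on generalizing s with
  | empty =>
    have : Subsingleton (monoIdeal K
        ((fun i => s + Finsupp.single i 1) '' ((∅ : Finset σ) : Set σ))) := by
      have h : monoIdeal K ((fun i => s + Finsupp.single i 1) '' ((∅ : Finset σ) : Set σ)) = ⊥ := by
        simp [monoIdeal]
      rw [h]
      infer_instance
    exact regLE_of_subsingleton _ _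
  | insert y T hy ih =>
    have hs : (s + Finsupp.single y 1).degree = s.degree + 1 := by simp
    have hprin := regLE_span_monomial (K := K) (s + Finsupp.single y 1)
    rw [hs] at hprin
    have hinf : ∀ m : σ →₀ ℕ,
        (∃ t ∈ (fun i => (s + Finsupp.single y 1) + Finsupp.single i 1) '' (T : Set σ), t ≤ m) ↔
        (∃ t ∈ (fun i => s + Finsupp.single i 1) '' (T : Set σ), t ≤ m) ∧
          ∃ t ∈ ({s + Finsupp.single y 1} : Set (σ →₀ ℕ)), t ≤ m := by
      intro m
      simp only [Set.exists_mem_image, Set.mem_singleton_iff, exists_eq_left]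
      constructor
      · rintro ⟨i, hi, h⟩
        refine ⟨⟨i, hi, le_trans ?_ h⟩, le_trans le_self_add h⟩
        exact add_le_add_left le_self_add _
      · rintro ⟨⟨i, hi, h⟩, h'⟩
        refine ⟨i, hi, add_single_le_iff.2 ⟨h', ?_⟩⟩
        have hiy : y ≠ i := fun h => hy (h ▸ hi)
        have := (add_single_le_iff.1 h).2
        simpa [Finsupp.single_apply, hiy] using this
    obtain ⟨f, p, hE⟩ := exists_shortExact_sup (homogeneousComponent_mem_monoIdeal (K := K))
      homogeneousComponent_mem_monoIdeal (monoIdeal_inf hinf) (monoIdeal_sup _ _)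
    have hlin := ih (s + Finsupp.single y 1)
    rw [hs] at hlin
    have := hlin.right hE (.middle (shortExact_prod _ _) (ih s) hprin)
    rwa [Finset.coe_insert, Set.image_insert_eq, Set.insert_eq, Set.union_comm]

/-- A nonzero ideal all of whose monomials have degree above `r` has regularity above `r`. -/
theorem not_regLE {r : ℕ} {I : Ideal (MvPolynomial σ K)} (hI : I ≠ ⊥)
    (h : ∀ x ∈ I, ∀ m, coeff m x ≠ 0 → r < m.degree) : ¬ RegLE r (ofIdeal I) := by
  intro hr
  obtain ⟨b, w, g, hw, hg, -⟩ := hr.step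
  have h0 : ∀ k, g k = 0 := by
    intro k
    refine Subtype.ext ?_
    by_contra hne
    obtain ⟨m, hm⟩ := exists_coeff_ne_zero hne
    have h1 := isHomogeneous_iff_degree.1 (show IsHomogeneous (g k).1 (w k) from hg.mem k) m hm
    have h2 := h _ (g k).2 m hm
    have h3 := hw k
    omega
  refine hI (eq_bot_iff.2 fun x hx => ?_)
  obtain ⟨v, hv⟩ := hg.surj ⟨x, hx⟩
  rw [Fintype.linearCombination_apply] at hv
  simp only [h0, smul_zero, Finset.sum_const_zero] at hv
  exact (congrArg Subtype.val hv).symm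

/-- Projection of a graded free module onto its degree `d` part. -/
def proj {b : ℕ} (w : Fin b → ℕ) (d : ℕ) :
    (Fin b → MvPolynomial σ K) →+ (Fin b → MvPolynomial σ K) where
  toFun v k := if w k ≤ d then homogeneousComponent (d - w k) (v k) else 0
  map_zero' := by ext1 k; simp
  map_add' u v := by
    ext1 k
    by_cases h : w k ≤ d <;> simp [h]

theorem coeff_proj {b : ℕ} (w : Fin b → ℕ) (d : ℕ) (v : Fin b → MvPolynomial σ K) (k : Fin b)
    (m : σ →₀ ℕ) : coeff m (proj w d v k) = if w k + m.degree = d then coeff m (v k) else 0 := by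
  change coeff m (if w k ≤ d then homogeneousComponent (d - w k) (v k) else 0) = _
  by_cases h : w k ≤ d
  · rw [if_pos h, coeff_homogeneousComponent]
    refine if_congr ?_ rfl rfl
    omega
  · rw [if_neg h, if_neg (by omega), coeff_zero]

theorem proj_of_mem {b : ℕ} {w : Fin b → ℕ} {d e : ℕ} {v : Fin b → MvPolynomial σ K}
    (hv : v ∈ freePiece w e) : proj w d v = if e = d then v else 0 := by
  ext k m
  rw [coeff_proj]
  by_cases h0 : coeff m (v k) = 0
  · rw [h0, ite_self]
    split_ifs <;> simp [h0]
  · rw [hv k m h0]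
    split_ifs <;> simp

/-- A graded map from a free module commutes with homogeneous projections. -/
theorem exists_mem_freePiece_eq {N : Type u} [AddCommGroup N] [Module (MvPolynomial σ K) N]
    {b : ℕ} (w : Fin b → ℕ) (φ : (Fin b → MvPolynomial σ K) →ₗ[MvPolynomial σ K] N) (d : ℕ)
    (pr : N →+ N) (hself : ∀ v ∈ freePiece w d, pr (φ v) = φ v)
    (hzero : ∀ e, e ≠ d → ∀ v ∈ freePiece w e, pr (φ v) = 0) (v : Fin b → MvPolynomial σ K) :
    ∃ u ∈ freePiece w d, φ u = pr (φ v) := by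
  classical
  have hadd : ∀ v₁ v₂, (∃ u ∈ freePiece w d, φ u = pr (φ v₁)) →
      (∃ u ∈ freePiece w d, φ u = pr (φ v₂)) → ∃ u ∈ freePiece w d, φ u = pr (φ (v₁ + v₂)) := by
    rintro v₁ v₂ ⟨u₁, h₁, e₁⟩ ⟨u₂, h₂, e₂⟩
    exact ⟨u₁ + u₂, add_mem h₁ h₂, by rw [map_add, map_add, map_add, e₁, e₂]⟩
  have hsingle : ∀ k (q : MvPolynomial σ K),
      ∃ u ∈ freePiece w d, φ u = pr (φ (Pi.single k q)) := by
    intro k q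
    induction q using MvPolynomial.induction_on' with
    | monomial m c =>
      have hmem : (Pi.single k (monomial m c) : Fin b → MvPolynomial σ K) ∈
          freePiece w (w k + m.degree) := by
        intro l m' hm'
        by_cases hl : l = k
        · subst hl
          rw [Pi.single_eq_same, coeff_monomial] at hm'
          by_cases hmm : m = m'
          · rw [hmm]
          · simp [hmm] at hm'
        · simp [Pi.single_eq_of_ne hl] at hm'
      by_cases hd : w k + m.degree = d
      · rw [hd] at hmem
        exact ⟨_, hmem, (hself _ hmem).symm⟩
      · exact ⟨0, zero_mem _, by rw [hzero _ hd _ hmem, map_zero]⟩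
    | add p q hp hq =>
      rw [Pi.single_add]
      exact hadd _ _ hp hq
  rw [← Finset.univ_sum_single v]
  refine Finset.sum_induction _ (fun v => ∃ u ∈ freePiece w d, φ u = pr (φ v)) hadd
    ⟨0, zero_mem _, by simp⟩ fun k _ => hsingle k _

theorem map_eq_linearCombination {N : Type u} [AddCommGroup N] [Module (MvPolynomial σ K) N]
    {b : ℕ} (φ : (Fin b → MvPolynomial σ K) →ₗ[MvPolynomial σ K] N)
    (v : Fin b → MvPolynomial σ K) :
    φ v = Fintype.linearCombination (MvPolynomial σ K) (fun k => φ (Pi.single k 1)) v := by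
  rw [Fintype.linearCombination_apply]
  conv_lhs => rw [pi_eq_sum_univ' v, map_sum]
  simp only [map_smul]

theorem map_mem_freePiece {b c : ℕ} {w : Fin b → ℕ} {w' : Fin c → ℕ}
    (φ : (Fin b → MvPolynomial σ K) →ₗ[MvPolynomial σ K] (Fin c → MvPolynomial σ K))
    (h : ∀ k, φ (Pi.single k 1) ∈ freePiece w' (w k)) {d : ℕ} {v : Fin b → MvPolynomial σ K}
    (hv : v ∈ freePiece w d) : φ v ∈ freePiece w' d := by
  have := linearCombination_mem (M := ofSubmodule w' ⊤) (w := w)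
    (g := fun k => ⟨φ (Pi.single k 1), trivial⟩) h hv
  have h2 := map_eq_linearCombination φ v
  rw [h2]
  convert this using 1
  simp [Fintype.linearCombination_apply]

theorem map_isHomogeneous {b : ℕ} {w : Fin b → ℕ}
    (φ : (Fin b → MvPolynomial σ K) →ₗ[MvPolynomial σ K] MvPolynomial σ K)
    (h : ∀ k, (φ (Pi.single k 1)).IsHomogeneous (w k)) {d : ℕ} {v : Fin b → MvPolynomial σ K}
    (hv : v ∈ freePiece w d) : (φ v).IsHomogeneous d := by
  have := linearCombination_mem (M := ofIdeal ⊤) (w := w)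
    (g := fun k => ⟨φ (Pi.single k 1), trivial⟩) h hv
  have h2 := map_eq_linearCombination φ v
  rw [h2]
  change IsHomogeneous _ d at this
  convert this using 1
  simp [Fintype.linearCombination_apply]

/-- The regularity bound read off from a graded free resolution. -/
theorem regLE_of_resolution {r : ℕ} {I : Ideal (MvPolynomial σ K)} {b : ℕ → ℕ}
    {deg : (i : ℕ) → Fin (b i) → ℕ}
    {aug : (Fin (b 0) → MvPolynomial σ K) →ₗ[MvPolynomial σ K] MvPolynomial σ K}
    {d : (i : ℕ) → ((Fin (b (i + 1)) → MvPolynomial σ K) →ₗ[MvPolynomial σ K]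
      (Fin (b i) → MvPolynomial σ K))} (hres : IsGradedFreeResolution I b deg aug d)
    (hdeg : ∀ i k, deg i k ≤ r + i) : RegLE r (ofIdeal I) := by
  obtain ⟨haug, hhom, hmat, hker, hkers⟩ := hres
  refine ⟨fun s N => (s = r ∧ N = ofIdeal I) ∨
    ∃ i, s = r + i + 1 ∧ N = ofSubmodule (deg i) (LinearMap.range (d i)), ?_, .inl ⟨rfl, rfl⟩⟩
  rintro s N (⟨rfl, rfl⟩ | ⟨i, rfl, rfl⟩)
  · subst haug
    have hval : ∀ v, (Fintype.linearCombination (MvPolynomial σ K) (fun k =>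
        (⟨aug (Pi.single k 1), LinearMap.mem_range_self _ _⟩ : LinearMap.range aug)) v).1 =
        aug v := by
      intro v
      rw [map_eq_linearCombination aug v]
      simp [Fintype.linearCombination_apply]
    refine ⟨b 0, deg 0, fun k => ⟨aug (Pi.single k 1), LinearMap.mem_range_self _ _⟩,
      hdeg 0, ⟨hhom, ?_, ?_⟩, .inr ⟨0, rfl, ?_⟩⟩
    · rintro ⟨_, v, rfl⟩
      exact ⟨v, Subtype.ext (hval v)⟩
    · rintro e ⟨_, v, rfl⟩ he
      obtain ⟨u, hu, huv⟩ := exists_mem_freePiece_eq (deg 0) aug e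
        (homogeneousComponent e).toAddMonoidHom
        (fun v hv => by
          change homogeneousComponent e (aug v) = _
          rw [homogeneousComponent_of_mem (map_isHomogeneous aug hhom hv), if_pos rfl])
        (fun e' he' v hv => by
          change homogeneousComponent e (aug v) = _
          rw [homogeneousComponent_of_mem (map_isHomogeneous aug hhom hv), if_neg he'.symm]) v
      refine ⟨u, hu, Subtype.ext ?_⟩
      rw [hval, huv]
      change homogeneousComponent e (aug v) = aug v
      have he' : aug v ∈ homogeneousSubmodule σ K e := he
      rw [homogeneousComponent_of_mem he', if_pos rfl]
    · rw [← hker]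
      unfold syz
      congr 1
      ext v
      rw [LinearMap.mem_ker, LinearMap.mem_ker, ← hval]
      exact Subtype.ext_iff
  · have hgr : ∀ k, d i (Pi.single k 1) ∈ freePiece (deg i) (deg (i + 1) k) := fun k =>
      mem_freePiece_iff.2 (hmat i k)
    have hval : ∀ v, (Fintype.linearCombination (MvPolynomial σ K) (fun k =>
        (⟨d i (Pi.single k 1), LinearMap.mem_range_self _ _⟩ : LinearMap.range (d i))) v).1 =
        d i v := by
      intro v
      rw [map_eq_linearCombination (d i) v]
      simp [Fintype.linearCombination_apply]
    refine ⟨b (i + 1), deg (i + 1),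
      fun k => ⟨d i (Pi.single k 1), LinearMap.mem_range_self _ _⟩,
      hdeg (i + 1), ⟨hgr, ?_, ?_⟩, .inr ⟨i + 1, rfl, ?_⟩⟩
    · rintro ⟨_, v, rfl⟩
      exact ⟨v, Subtype.ext (hval v)⟩
    · rintro e ⟨_, v, rfl⟩ he
      obtain ⟨u, hu, huv⟩ := exists_mem_freePiece_eq (deg (i + 1)) (d i) e (proj (deg i) e)
        (fun v hv => by rw [proj_of_mem (map_mem_freePiece (d i) hgr hv), if_pos rfl])
        (fun e' he' v hv => by rw [proj_of_mem (map_mem_freePiece (d i) hgr hv), if_neg he']) v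
      refine ⟨u, hu, Subtype.ext ?_⟩
      have he' : d i v ∈ freePiece (deg i) e := he
      rw [hval, huv, proj_of_mem he', if_pos rfl]
    · rw [← hkers]
      unfold syz
      congr 1
      ext v
      rw [LinearMap.mem_ker, LinearMap.mem_ker, ← hval]
      exact Subtype.ext_iff

/-- One syzygy step, keeping the next regularity bound. -/
structure Cover (r : ℕ) (M : GrMod σ K) where
  /-- the number of generators -/
  b : ℕ
  /-- the degrees of the generators -/
  w : Fin b → ℕ
  /-- the generators -/
  g : Fin b → M.carrier
  le : ∀ k, w k ≤ r
  generates : M.Generates w g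
  next : RegLE (r + 1) (syz w g)

theorem RegLE.nonempty_cover {r : ℕ} {M : GrMod σ K} (h : RegLE r M) : Nonempty (Cover r M) := by
  obtain ⟨b, w, g, h1, h2, h3⟩ := h.step
  exact ⟨⟨b, w, g, h1, h2, h3⟩⟩

/-- A choice of a cover. -/
def RegLE.cover {r : ℕ} {M : GrMod σ K} (h : RegLE r M) : Cover r M := h.nonempty_cover.some

/-- The iterated syzygy modules. -/
def syzSeq {r : ℕ} {M : GrMod σ K} (h : RegLE r M) :
    (i : ℕ) → {N : GrMod σ K // RegLE (r + i) N}
  | 0 => ⟨M, h⟩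
  | i + 1 => ⟨syz (syzSeq h i).2.cover.w (syzSeq h i).2.cover.g, (syzSeq h i).2.cover.next⟩

theorem exists_resolution {r : ℕ} {I : Ideal (MvPolynomial σ K)} (h : RegLE r (ofIdeal I)) :
    ∃ b deg aug d, IsGradedFreeResolution I b deg aug d ∧ ∀ i k, deg i k ≤ r + i := by
  let c := fun i => (syzSeq h i).2.cover
  let φ : ∀ i, (Fin (c i).b → MvPolynomial σ K) →ₗ[MvPolynomial σ K] (syzSeq h i).1.carrier :=
    fun i => Fintype.linearCombination (MvPolynomial σ K) (c i).g
  let aug : (Fin (c 0).b → MvPolynomial σ K) →ₗ[MvPolynomial σ K] MvPolynomial σ K :=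
    (Submodule.subtype I) ∘ₗ φ 0
  let δ : ∀ i, (Fin (c (i + 1)).b → MvPolynomial σ K) →ₗ[MvPolynomial σ K]
      (Fin (c i).b → MvPolynomial σ K) :=
    fun i => (LinearMap.ker (φ i)).subtype ∘ₗ φ (i + 1)
  have hsingle : ∀ i k, φ i (Pi.single k 1) = (c i).g k := by
    intro i k
    simp [φ]
  have hδ : ∀ i, LinearMap.range (δ i) = LinearMap.ker (φ i) := by
    intro i
    ext v
    constructor
    · rintro ⟨u, rfl⟩
      exact (φ (i + 1) u).2
    · intro hv
      obtain ⟨u, hu⟩ := (c (i + 1)).generates.surj ⟨v, hv⟩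
      exact ⟨u, congrArg Subtype.val hu⟩
  refine ⟨fun i => (c i).b, fun i => (c i).w, aug, δ, ⟨?_, ?_, ?_, ?_, ?_⟩, fun i => (c i).le⟩
  · ext x
    constructor
    · rintro ⟨u, rfl⟩
      exact (φ 0 u).2
    · intro hx
      obtain ⟨u, hu⟩ := (c 0).generates.surj ⟨x, hx⟩
      exact ⟨u, congrArg Subtype.val hu⟩
  · intro k
    have := (c 0).generates.mem k
    rw [← hsingle 0 k] at this
    exact this
  · intro i k
    have := (c (i + 1)).generates.mem k
    rw [← hsingle (i + 1) k] at this
    exact mem_freePiece_iff.1 this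
  · rw [hδ]
    exact LinearMap.ker_comp_of_ker_eq_bot _ (Submodule.ker_subtype _)
  · intro i
    rw [hδ (i + 1)]
    exact LinearMap.ker_comp_of_ker_eq_bot _ (Submodule.ker_subtype _)

theorem idealReg_eq (I : Ideal (MvPolynomial σ K)) :
    idealReg I = sInf {r : ℕ | RegLE r (ofIdeal I)} := by
  unfold idealReg
  congr 1
  ext r
  constructor
  · rintro ⟨b, deg, aug, d, h1, h2⟩
    exact regLE_of_resolution h1 h2
  · exact exists_resolution

/-- The exponent of the square-free monomial supported on `F`. -/
def expo {n : ℕ} (F : Finset (Fin n)) : Fin n →₀ ℕ := ∑ i ∈ F, Finsupp.single i 1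

theorem expo_apply {n : ℕ} (F : Finset (Fin n)) (j : Fin n) :
    expo F j = if j ∈ F then 1 else 0 := by
  simp [expo, Finsupp.finsetSum_apply, Finsupp.single_apply]

theorem expo_le_iff {n : ℕ} {F : Finset (Fin n)} {m : Fin n →₀ ℕ} :
    expo F ≤ m ↔ ∀ i ∈ F, 1 ≤ m i := by
  constructor
  · intro h i hi
    simpa [expo_apply, hi] using h i
  · intro h i
    rw [expo_apply]
    split_ifs with hi
    · exact h i hi
    · exact Nat.zero_le _

theorem degree_expo {n : ℕ} (F : Finset (Fin n)) : (expo F).degree = F.card := by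
  simp [expo]

theorem monomial_expo {n : ℕ} (F : Finset (Fin n)) :
    (monomial (expo F) 1 : MvPolynomial (Fin n) K) = ∏ i ∈ F, X i := by
  rw [expo, monomial_sum_one]
  rfl

theorem circuitIdeal_eq {n : ℕ} (C : Finset (Finset (Fin n))) :
    circuitIdeal K C = monoIdeal K (expo '' (C : Set (Finset (Fin n)))) := by
  rw [circuitIdeal, monoIdeal, Set.image_image]
  simp only [monomial_expo]

theorem monoIdeal_expo_ne_bot {n : ℕ} {C : Set (Finset (Fin n))} (hC : C.Nonempty) :
    monoIdeal K (expo '' C) ≠ ⊥ := by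
  obtain ⟨F, hF⟩ := hC
  have hmem : (monomial (expo F) 1 : MvPolynomial (Fin n) K) ∈ monoIdeal K (expo '' C) :=
    Ideal.subset_span ⟨_, ⟨F, hF, rfl⟩, rfl⟩
  intro h
  rw [h, Ideal.mem_bot, monomial_eq_zero] at hmem
  exact one_ne_zero hmem

theorem lt_degree_of_mem_monoIdeal {n d r : ℕ} {C : Set (Finset (Fin n))}
    (hC : ∀ F ∈ C, F.card = d) (hr : r < d) :
    ∀ x ∈ monoIdeal K (expo '' C), ∀ m, coeff m x ≠ 0 → r < m.degree := by
  intro x hx m hm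
  obtain ⟨_, ⟨F, hF, rfl⟩, hle⟩ := mem_monoIdeal.1 hx m hm
  have := Finsupp.degree_mono hle
  rw [degree_expo, hC F hF] at this
  omega

theorem prod_three {n : ℕ} {i j k : Fin n} (hij : i ≠ j) (hik : i ≠ k) (hjk : j ≠ k) :
    (X i * X j * X k : MvPolynomial (Fin n) K) = monomial (expo {i, j, k}) 1 := by
  rw [monomial_expo, Finset.prod_insert (by simp [hij, hik]), Finset.prod_pair hjk, mul_assoc]

theorem monoIdeal_le_of_forall {A B : Set (σ →₀ ℕ)} (h : ∀ s ∈ A, ∃ t ∈ B, t ≤ s) :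
    monoIdeal K A ≤ monoIdeal K B := by
  intro x hx
  rw [mem_monoIdeal] at hx ⊢
  intro m hm
  obtain ⟨s, hs, hsm⟩ := hx m hm
  obtain ⟨t, ht, hts⟩ := h s hs
  exact ⟨t, ht, hts.trans hsm⟩

theorem expo_pair_add {n : ℕ} {a b i : Fin n} (ha : i ≠ a) (hb : i ≠ b) :
    expo {a, b} + Finsupp.single i 1 = expo {a, b, i} := by
  ext j
  simp only [Finsupp.add_apply, expo_apply, Finsupp.single_apply, Finset.mem_insert,
    Finset.mem_singleton]
  by_cases hj : i = j
  · subst hj; simp [ha, hb]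
  · simp [hj, Ne.symm hj]

/-- Adding the two circuits through an edge of a clutter, when these span with a further edge a
complete clutter on four vertices, does not change the bounds on regularity. -/
theorem regLE_iff_add_two_triangles {n : ℕ} (C : Finset (Finset (Fin n)))
    (a b c e : Fin n) (hab : a ≠ b) (hac : a ≠ c) (hae : a ≠ e) (hbc : b ≠ c) (hbe : b ≠ e)
    (hce : c ≠ e)
    (habc : {a, b, c} ∈ C) (habe : {a, b, e} ∈ C) (hace : {a, c, e} ∈ C) (hbce : {b, c, e} ∈ C)
    (hedge : ∀ F ∈ C, {a, b} ⊆ F → F = {a, b, c} ∨ F = {a, b, e}) {r : ℕ} (hr : 3 ≤ r) :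
    RegLE r (ofIdeal (monoIdeal K (expo '' (clutterCompl 3 C : Set (Finset (Fin n)))))) ↔
      RegLE r (ofIdeal (monoIdeal K (expo ''
        (clutterCompl 3 C ∪ {{a, b, c}, {a, b, e}} : Set (Finset (Fin n)))))) := by
  have hdeg : (expo {a, b}).degree + 1 ≤ r := by
    rw [degree_expo, Finset.card_pair hab]
    exact hr
  have hcompl : ∀ i, i ≠ a → i ≠ b → i ≠ c → i ≠ e → {a, b, i} ∈ clutterCompl 3 C := by
    intro i hia hib hic hie
    rw [clutterCompl, Finset.mem_sdiff, Finset.mem_powersetCard]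
    refine ⟨⟨Finset.subset_univ _, Finset.card_eq_three.2
      ⟨a, b, i, hab, hia.symm, hib.symm, rfl⟩⟩, fun h => ?_⟩
    have hi : i ∈ ({a, b, i} : Finset (Fin n)) := by simp
    rcases hedge _ h (by intro x; simp; tauto) with h | h
    · rw [h] at hi; simp [hia, hib, hic] at hi
    · rw [h] at hi; simp [hia, hib, hie] at hi
  refine regLE_iff_of_sup
    (A := (fun i => expo {a, b} + Finsupp.single i 1) ''
      (({a, b}ᶜ : Finset (Fin n)) : Set (Fin n)))
    (C := (fun i => expo {a, b} + Finsupp.single i 1) ''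
      (({a, b, c, e}ᶜ : Finset (Fin n)) : Set (Fin n)))
    ((regLE_monomial_mul_variables _ _).mono hdeg) ((regLE_monomial_mul_variables _ _).mono hdeg)
    ?_ ?_
  · intro m
    simp only [Set.exists_mem_image, Finset.coe_compl, Set.mem_compl_iff, Finset.mem_coe,
      Finset.mem_insert, Finset.mem_singleton, not_or]
    constructor
    · rintro ⟨i, ⟨hia, hib, hic, hie⟩, h⟩
      refine ⟨⟨i, ⟨hia, hib⟩, h⟩, {a, b, i}, hcompl i hia hib hic hie, ?_⟩
      rwa [← expo_pair_add hia hib]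
    · rintro ⟨⟨i, ⟨hia, hib⟩, h⟩, F, hF, hFm⟩
      rw [clutterCompl, Finset.mem_sdiff, Finset.mem_powersetCard] at hF
      obtain ⟨⟨-, hcard⟩, hFC⟩ := hF
      rw [expo_le_iff] at hFm
      have hab_le : expo {a, b} ≤ m := le_trans le_self_add h
      by_cases hsub : F ⊆ {a, b, c, e}
      · exfalso
        apply hFC
        have hc4 : ({a, b, c, e} : Finset (Fin n)).card = 4 := by
          rw [Finset.card_insert_of_notMem (by simp [hab, hac, hae]),
            Finset.card_insert_of_notMem (by simp [hbc, hbe]), Finset.card_pair hce]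
        have hdiff : (({a, b, c, e} : Finset (Fin n)) \ F).card = 1 := by
          rw [Finset.card_sdiff_of_subset hsub, hc4, hcard]
        obtain ⟨x, hx⟩ := Finset.card_eq_one.1 hdiff
        have hFx : F = ({a, b, c, e} : Finset (Fin n)).erase x := by
          rw [← Finset.sdiff_singleton_eq_erase, ← hx, Finset.sdiff_sdiff_eq_self hsub]
        have hxm : x ∈ ({a, b, c, e} : Finset (Fin n)) \ F := by rw [hx]; simp
        have hxm' := (Finset.mem_sdiff.1 hxm).1
        simp only [Finset.mem_insert, Finset.mem_singleton] at hxm'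
        rcases hxm' with rfl | rfl | rfl | rfl
        · convert hbce using 1
          rw [hFx]; ext y; simp only [Finset.mem_erase, Finset.mem_insert, Finset.mem_singleton]
          grind
        · convert hace using 1
          rw [hFx]; ext y; simp only [Finset.mem_erase, Finset.mem_insert, Finset.mem_singleton]
          grind
        · convert habe using 1
          rw [hFx]; ext y; simp only [Finset.mem_erase, Finset.mem_insert, Finset.mem_singleton]
          grind
        · convert habc using 1
          rw [hFx]; ext y; simp only [Finset.mem_erase, Finset.mem_insert, Finset.mem_singleton]
          grind
      · obtain ⟨j, hjF, hj⟩ := Finset.not_subset.1 hsub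
        simp only [Finset.mem_insert, Finset.mem_singleton, not_or] at hj
        refine ⟨j, hj, add_single_le_iff.2 ⟨hab_le, ?_⟩⟩
        rw [expo_apply, if_neg (by simp [hj.1, hj.2.1])]
        simpa using hFm j hjF
  · rw [monoIdeal_sup]
    apply le_antisymm
    · apply monoIdeal_le_of_forall
      rintro s (⟨i, hi, rfl⟩ | ⟨F, hF, rfl⟩)
      · simp only [Finset.coe_compl, Set.mem_compl_iff, Finset.mem_coe,
          Finset.mem_insert, Finset.mem_singleton, not_or] at hi
        refine ⟨_, ⟨{a, b, i}, ?_, rfl⟩, (expo_pair_add hi.1 hi.2).ge⟩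
        by_cases hic : i = c
        · simp [hic]
        by_cases hie : i = e
        · simp [hie]
        exact .inl (hcompl i hi.1 hi.2 hic hie)
      · exact ⟨_, ⟨F, .inl hF, rfl⟩, le_rfl⟩
    · apply monoIdeal_le_of_forall
      rintro s ⟨F, hF | rfl | rfl, rfl⟩
      · exact ⟨_, .inr ⟨F, hF, rfl⟩, le_rfl⟩
      · exact ⟨_, .inl ⟨c, by simp [hac.symm, hbc.symm], rfl⟩,
          (expo_pair_add hac.symm hbc.symm).le⟩
      · exact ⟨_, .inl ⟨e, by simp [hae.symm, hbe.symm], rfl⟩,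
          (expo_pair_add hae.symm hbe.symm).le⟩

end GrMod

/-- Let `C ≠ C_{n,3}` be a 3-uniform clutter on `[n]` (`n ≥ 4`, vertices
`1,2,3,4` being `⟨0⟩,⟨1⟩,⟨2⟩,⟨3⟩`) with `{1,2,3}, {1,2,4}, {1,3,4}, {2,3,4} ∈ C`, and
suppose no circuit of `C` other than `{1,2,3}` and `{1,2,4}` contains `{1,2}`.
If `I = I(C̄)` and `J = I + (x₁x₂x₃, x₁x₂x₄)`, then `reg I = reg J`. -/
theorem reg_eq_add_two_triangles {K : Type*} [Field K] (n : ℕ) (hn : 4 ≤ n)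
    (C : Finset (Finset (Fin n))) (hunif : ∀ F ∈ C, F.card = 3)
    (hneq : C ≠ Finset.powersetCard 3 (Finset.univ : Finset (Fin n)))
    (h123 : ({⟨0, by omega⟩, ⟨1, by omega⟩, ⟨2, by omega⟩} : Finset (Fin n)) ∈ C)
    (h124 : ({⟨0, by omega⟩, ⟨1, by omega⟩, ⟨3, by omega⟩} : Finset (Fin n)) ∈ C)
    (h134 : ({⟨0, by omega⟩, ⟨2, by omega⟩, ⟨3, by omega⟩} : Finset (Fin n)) ∈ C)
    (h234 : ({⟨1, by omega⟩, ⟨2, by omega⟩, ⟨3, by omega⟩} : Finset (Fin n)) ∈ C)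
    (h12 : ∀ F ∈ C, ({⟨0, by omega⟩, ⟨1, by omega⟩} : Finset (Fin n)) ⊆ F →
      F = ({⟨0, by omega⟩, ⟨1, by omega⟩, ⟨2, by omega⟩} : Finset (Fin n)) ∨
      F = ({⟨0, by omega⟩, ⟨1, by omega⟩, ⟨3, by omega⟩} : Finset (Fin n))) :
    idealReg (circuitIdeal K (clutterCompl 3 C)) =
      idealReg (circuitIdeal K (clutterCompl 3 C) +
        Ideal.span {(X ⟨0, by omega⟩ : MvPolynomial (Fin n) K) * X ⟨1, by omega⟩ * X ⟨2, by omega⟩,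
          (X ⟨0, by omega⟩ : MvPolynomial (Fin n) K) * X ⟨1, by omega⟩ * X ⟨3, by omega⟩}) := by
  have hne : ∀ {i j : ℕ} (hi : i < n) (hj : j < n), i ≠ j → (⟨i, hi⟩ : Fin n) ≠ ⟨j, hj⟩ :=
    fun _ _ h h' => h (congrArg Fin.val h')
  have h01 := hne (i := 0) (j := 1) (by omega) (by omega) (by omega)
  have h02 := hne (i := 0) (j := 2) (by omega) (by omega) (by omega)
  have h03 := hne (i := 0) (j := 3) (by omega) (by omega) (by omega)
  have h12' := hne (i := 1) (j := 2) (by omega) (by omega) (by omega)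
  have h13 := hne (i := 1) (j := 3) (by omega) (by omega) (by omega)
  have h23 := hne (i := 2) (j := 3) (by omega) (by omega) (by omega)
  have hJ : circuitIdeal K (clutterCompl 3 C) +
        Ideal.span {(X ⟨0, by omega⟩ : MvPolynomial (Fin n) K) * X ⟨1, by omega⟩ * X ⟨2, by omega⟩,
          (X ⟨0, by omega⟩ : MvPolynomial (Fin n) K) * X ⟨1, by omega⟩ * X ⟨3, by omega⟩} =
      GrMod.monoIdeal K (GrMod.expo '' (clutterCompl 3 C ∪
        {{⟨0, by omega⟩, ⟨1, by omega⟩, ⟨2, by omega⟩},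
          {⟨0, by omega⟩, ⟨1, by omega⟩, ⟨3, by omega⟩}} : Set (Finset (Fin n)))) := by
    rw [GrMod.prod_three h01 h02 h12', GrMod.prod_three h01 h03 h13, GrMod.circuitIdeal_eq,
      Set.image_union, ← GrMod.monoIdeal_sup, Set.image_pair]
    congr 1
    rw [GrMod.monoIdeal, Set.image_pair]
  have hnonempty : (clutterCompl 3 C : Set (Finset (Fin n))).Nonempty := by
    rw [Finset.coe_nonempty, clutterCompl, Finset.sdiff_nonempty]
    intro h
    exact hneq (Finset.Subset.antisymm
      (fun F hF => Finset.mem_powersetCard.2 ⟨Finset.subset_univ _, hunif F hF⟩) h)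
  have hcard : ∀ F ∈ clutterCompl 3 C, F.card = 3 := fun F hF =>
    (Finset.mem_powersetCard.1 (Finset.mem_sdiff.1 hF).1).2
  rw [hJ, GrMod.circuitIdeal_eq, GrMod.idealReg_eq, GrMod.idealReg_eq]
  congr 1
  ext r
  rcases lt_or_ge r 3 with hr | hr
  · refine iff_of_false
      (GrMod.not_regLE (GrMod.monoIdeal_expo_ne_bot hnonempty)
        (GrMod.lt_degree_of_mem_monoIdeal hcard hr))
      (GrMod.not_regLE (GrMod.monoIdeal_expo_ne_bot (hnonempty.mono Set.subset_union_left))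
        (GrMod.lt_degree_of_mem_monoIdeal ?_ hr))
    rintro F (hF | rfl | rfl)
    · exact hcard F hF
    · exact hunif _ h123
    · exact hunif _ h124
  · exact GrMod.regLE_iff_add_two_triangles C _ _ _ _ h01 h02 h03 h12' h13 h23 h123 h124 h134 h234
      h12 hr
end
end

section
/- Let C be a 3-uniform clutter on [n] and let C' be a flip of C. Then reg(I(C̄)) = reg(I(C̄')). -/
open MvPolynomial

noncomputable section

universe u

/-- A module over `K[xᵢ : i ∈ σ]` with additive subgroups of homogeneous elements in each degree,
compatible with multiplication by forms. -/
structure GradedMod (σ : Type) (K : Type u) [Field K] where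
  /-- The underlying type. -/
  carrier : Type u
  [addCommGroup : AddCommGroup carrier]
  [module : Module (MvPolynomial σ K) carrier]
  /-- The homogeneous elements of a given degree. -/
  hom : ℕ → AddSubgroup carrier
  smul_mem : ∀ {e j : ℕ} {f : MvPolynomial σ K} {m : carrier},
    f.IsHomogeneous e → m ∈ hom j → f • m ∈ hom (j + e)

namespace GradedMod

attribute [instance] GradedMod.addCommGroup GradedMod.module

variable {σ : Type} {K : Type u} [Field K]

/-- A linear map preserving degrees. -/
def IsGraded {M N : GradedMod σ K} (f : M.carrier →ₗ[MvPolynomial σ K] N.carrier) : Prop :=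
  ∀ j, ∀ x ∈ M.hom j, f x ∈ N.hom j

/-- A degree-preserving linear map which is surjective, also on the homogeneous elements of each
degree. -/
structure IsCover {M N : GradedMod σ K} (f : M.carrier →ₗ[MvPolynomial σ K] N.carrier) :
    Prop where
  isGraded : IsGraded f
  surj : Function.Surjective f
  lift : ∀ j, ∀ y ∈ N.hom j, ∃ x ∈ M.hom j, f x = y

/-- A submodule, with the homogeneous elements of the ambient module. -/
abbrev sub (M : GradedMod σ K) (N : Submodule (MvPolynomial σ K) M.carrier) : GradedMod σ K where
  carrier := N
  hom j := (M.hom j).comap N.subtype.toAddMonoidHom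
  smul_mem hf hm := M.smul_mem hf hm

/-- The kernel of a linear map, as a graded module. -/
abbrev ker {M N : GradedMod σ K} (f : M.carrier →ₗ[MvPolynomial σ K] N.carrier) :
    GradedMod σ K :=
  M.sub (LinearMap.ker f)

/-- The product of two graded modules. -/
abbrev prod (M N : GradedMod σ K) : GradedMod σ K where
  carrier := M.carrier × N.carrier
  hom j := (M.hom j).prod (N.hom j)
  smul_mem hf hm := ⟨M.smul_mem hf hm.1, N.smul_mem hf hm.2⟩

/-- The free module with generators in the degrees `deg k`. -/
abbrev free {b : ℕ} (deg : Fin b → ℕ) : GradedMod σ K where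
  carrier := Fin b → MvPolynomial σ K
  hom j :=
    { carrier := {v | ∀ l, v l = 0 ∨ ∃ e, deg l + e = j ∧ (v l).IsHomogeneous e}
      zero_mem' := fun _ => Or.inl rfl
      add_mem' := by
        intro v w hv hw l
        rcases hv l with h | ⟨e, he, h⟩
        · simpa [h] using hw l
        · rcases hw l with h' | ⟨e', he', h'⟩
          · exact Or.inr ⟨e, he, by simpa [h'] using h⟩
          · obtain rfl : e = e' := by omega
            exact Or.inr ⟨e, he, h.add h'⟩
      neg_mem' := by
        intro v hv l
        rcases hv l with h | ⟨e, he, h⟩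
        · exact Or.inl (by simp [h])
        · exact Or.inr ⟨e, he, (homogeneousSubmodule σ K e).neg_mem h⟩ }
  smul_mem := by
    intro e j f v hf hv l
    rcases hv l with h | ⟨e', he', h⟩
    · exact Or.inl (by simp [h])
    · exact Or.inr ⟨e + e', by omega, hf.mul h⟩

/-- The polynomial ring as a graded module over itself. -/
abbrev poly (σ : Type) (K : Type u) [Field K] : GradedMod σ K where
  carrier := MvPolynomial σ K
  hom j := (homogeneousSubmodule σ K j).toAddSubgroup
  smul_mem {e j f m} hf hm := by
    rw [add_comm]
    exact IsHomogeneous.mul hf hm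

theorem mem_hom_free {b : ℕ} {deg : Fin b → ℕ} {j : ℕ} {v : Fin b → MvPolynomial σ K} :
    v ∈ (free deg).hom j ↔ ∀ l, v l = 0 ∨ ∃ e, deg l + e = j ∧ (v l).IsHomogeneous e :=
  Iff.rfl

theorem single_mem_hom_free {b : ℕ} (deg : Fin b → ℕ) (k : Fin b) :
    (Pi.single k 1 : Fin b → MvPolynomial σ K) ∈ (free deg).hom (deg k) := by
  rw [mem_hom_free]
  intro l
  by_cases h : l = k
  · subst h
    exact Or.inr ⟨0, rfl, by simpa using isHomogeneous_one σ K⟩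
  · exact Or.inl (by simp [h])

theorem map_free_eq_sum {b : ℕ} (N : GradedMod σ K)
    (π : (Fin b → MvPolynomial σ K) →ₗ[MvPolynomial σ K] N.carrier)
    (v : Fin b → MvPolynomial σ K) :
    π v = ∑ k, v k • π (Pi.single k 1) := by
  rw [LinearMap.pi_apply_eq_sum_univ π v]
  refine Finset.sum_congr rfl fun k _ => ?_
  congr 2
  ext1 j
  simp [Pi.single_apply, eq_comm]

theorem isGraded_free {b : ℕ} {deg : Fin b → ℕ} {N : GradedMod σ K}
    {π : (free deg).carrier →ₗ[MvPolynomial σ K] N.carrier}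
    (h : ∀ k, π (Pi.single k 1 : Fin b → MvPolynomial σ K) ∈ N.hom (deg k)) : IsGraded π := by
  intro j v hv
  rw [map_free_eq_sum N π v]
  refine AddSubgroup.sum_mem _ fun k _ => ?_
  rcases hv k with h0 | ⟨e, rfl, he⟩
  · rw [h0, zero_smul]
    exact zero_mem _
  · exact N.smul_mem he (h k)

/-- `M` is covered by a free module generated in degrees `≤ s` with kernel satisfying `X` in
degree `s + 1`. -/
def HasStep (X : GradedMod σ K → ℕ → Prop) (M : GradedMod σ K) (s : ℕ) : Prop :=
  ∃ (b : ℕ) (deg : Fin b → ℕ) (π : (free deg).carrier →ₗ[MvPolynomial σ K] M.carrier),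
    (∀ k, deg k ≤ s) ∧ IsCover π ∧ X (ker π) (s + 1)

theorem HasStep.mono {X Y : GradedMod σ K → ℕ → Prop} (h : ∀ M s, X M s → Y M s)
    {M : GradedMod σ K} {s : ℕ} (hM : HasStep X M s) : HasStep Y M s := by
  obtain ⟨b, deg, π, h1, h2, h3⟩ := hM
  exact ⟨b, deg, π, h1, h2, h _ _ h3⟩

/-- The greatest predicate with `RegLE M r → HasStep RegLE M r`: the module `M` has a graded free
resolution whose `i`-th term is generated in degrees `≤ r + i`. -/
def RegLE (M : GradedMod σ K) (r : ℕ) : Prop :=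
  ∃ X : GradedMod σ K → ℕ → Prop, (∀ N s, X N s → HasStep X N s) ∧ X M r

namespace RegLE

theorem step {M : GradedMod σ K} {r : ℕ} (h : RegLE M r) : HasStep RegLE M r := by
  obtain ⟨X, hX, hM⟩ := h
  exact (hX M r hM).mono fun N s hN => ⟨X, hX, hN⟩

theorem of_step {M : GradedMod σ K} {r : ℕ} (h : HasStep RegLE M r) : RegLE M r :=
  ⟨HasStep RegLE, fun _ _ h' => h'.mono fun _ _ h'' => h''.step, h⟩

theorem of_equiv {M N : GradedMod σ K} {r : ℕ} (h : RegLE M r)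
    (g : M.carrier →ₗ[MvPolynomial σ K] N.carrier) (hg : IsCover g)
    (hinj : Function.Injective g) : RegLE N r := by
  obtain ⟨b, deg, π, h1, h2, h3⟩ := h.step
  refine of_step ⟨b, deg, g ∘ₗ π, h1, ⟨fun j x hx => hg.1 _ _ (h2.1 _ _ hx),
    hg.2.comp h2.2, fun j y hy => ?_⟩, ?_⟩
  · obtain ⟨x, hx, rfl⟩ := hg.3 j y hy
    obtain ⟨z, hz, rfl⟩ := h2.3 j x hx
    exact ⟨z, hz, rfl⟩
  · have : LinearMap.ker (g ∘ₗ π) = LinearMap.ker π :=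
      LinearMap.ker_comp_of_ker_eq_bot _ (LinearMap.ker_eq_bot.2 hinj)
    unfold ker
    rw [this]
    exact h3

theorem mono {M : GradedMod σ K} {r r' : ℕ} (h : RegLE M r) (hr : r ≤ r') : RegLE M r' := by
  refine ⟨fun N s => ∃ s' ≤ s, RegLE N s', ?_, r, hr, h⟩
  rintro N s ⟨s', hs, hN⟩
  obtain ⟨b, deg, π, h1, h2, h3⟩ := hN.step
  exact ⟨b, deg, π, fun k => (h1 k).trans hs, h2, s' + 1, by omega, h3⟩

theorem of_subsingleton (M : GradedMod σ K) (r : ℕ) [hM : Subsingleton M.carrier] :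
    RegLE M r := by
  refine ⟨fun N _ => Subsingleton N.carrier, ?_, hM⟩
  intro N s hN
  refine ⟨0, Fin.elim0, 0, fun k => k.elim0, ⟨fun _ _ _ => zero_mem _,
    fun y => ⟨0, Subsingleton.elim _ _⟩, fun j y _ => ⟨0, zero_mem _, Subsingleton.elim _ _⟩⟩, ?_⟩
  have : Subsingleton (free (σ := σ) (K := K) Fin.elim0).carrier :=
    inferInstanceAs (Subsingleton (Fin 0 → MvPolynomial σ K))
  exact inferInstanceAs (Subsingleton (LinearMap.ker (_ : _ →ₗ[MvPolynomial σ K] _)))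

theorem of_free_equiv {b : ℕ} {deg : Fin b → ℕ} {M : GradedMod σ K} {r : ℕ}
    (h : ∀ k, deg k ≤ r) (π : (free deg).carrier →ₗ[MvPolynomial σ K] M.carrier)
    (hπ : IsCover π) (hinj : Function.Injective π) : RegLE M r := by
  refine of_step ⟨b, deg, π, h, hπ, ?_⟩
  have : Subsingleton (ker π).carrier :=
    (Submodule.subsingleton_iff_eq_bot).2 (LinearMap.ker_eq_bot.2 hinj)
  exact of_subsingleton _ _

theorem of_free {b : ℕ} {deg : Fin b → ℕ} {r : ℕ} (h : ∀ k, deg k ≤ r) :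
    RegLE (GradedMod.free deg : GradedMod σ K) r :=
  of_free_equiv h LinearMap.id ⟨fun _ _ h => h, Function.surjective_id, fun _ y hy => ⟨y, hy, rfl⟩⟩
    Function.injective_id

end RegLE

theorem mem_hom_free_append {b c : ℕ} {deg : Fin b → ℕ} {deg' : Fin c → ℕ} {j : ℕ}
    {v : Fin (b + c) → MvPolynomial σ K} :
    v ∈ (free (Fin.append deg deg')).hom j ↔
      (fun k => v (Fin.castAdd c k)) ∈ (free deg).hom j ∧
        (fun k => v (Fin.natAdd b k)) ∈ (free deg').hom j := by
  constructor
  · intro h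
    exact ⟨fun l => by simpa using h (Fin.castAdd c l), fun l => by simpa using h (Fin.natAdd b l)⟩
  · rintro ⟨h, h'⟩ l
    induction l using Fin.addCases with
    | left l => simpa using h l
    | right l => simpa using h' l

theorem exists_lift_free {b : ℕ} {deg : Fin b → ℕ} {M N : GradedMod σ K}
    {f : M.carrier →ₗ[MvPolynomial σ K] N.carrier} (hf : IsCover f)
    {π : (free deg).carrier →ₗ[MvPolynomial σ K] N.carrier} (hπ : IsGraded π) :
    ∃ g : (free deg).carrier →ₗ[MvPolynomial σ K] M.carrier,
      IsGraded g ∧ ∀ v, f (g v) = π v := by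
  choose m hm hmf using fun k => hf.lift (deg k) (π (Pi.single k 1 : Fin b → MvPolynomial σ K))
    (hπ _ _ (single_mem_hom_free deg k))
  refine ⟨Fintype.linearCombination (MvPolynomial σ K) m, isGraded_free fun k => ?_, fun v => ?_⟩
  · rw [Fintype.linearCombination_apply_single, one_smul]
    exact hm k
  · rw [Fintype.linearCombination_apply, map_sum, map_free_eq_sum N π v]
    simp only [map_smul, hmf]

namespace RegLE

theorem extension {M N : GradedMod σ K} {r : ℕ} (f : M.carrier →ₗ[MvPolynomial σ K] N.carrier)
    (hf : IsCover f) (hker : RegLE (ker f) r) (hN : RegLE N r) : RegLE M r := by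
  refine ⟨fun M r => ∃ (N : GradedMod σ K) (f : M.carrier →ₗ[MvPolynomial σ K] N.carrier),
    IsCover f ∧ RegLE (ker f) r ∧ RegLE N r, ?_, N, f, hf, hker, hN⟩
  clear! M N r
  rintro M r ⟨N, f, hf, hker, hN⟩
  obtain ⟨b, deg, p, hdeg, hp, hp'⟩ := hker.step
  obtain ⟨c, deg', q, hdeg', hq, hq'⟩ := hN.step
  obtain ⟨g, hg, hfg⟩ := exists_lift_free hf hq.isGraded
  let L : (Fin (b + c) → MvPolynomial σ K) →ₗ[MvPolynomial σ K] (Fin b → MvPolynomial σ K) :=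
    LinearMap.funLeft _ _ (Fin.castAdd c)
  let R : (Fin (b + c) → MvPolynomial σ K) →ₗ[MvPolynomial σ K] (Fin c → MvPolynomial σ K) :=
    LinearMap.funLeft _ _ (Fin.natAdd b)
  let π : (free (Fin.append deg deg')).carrier →ₗ[MvPolynomial σ K] M.carrier :=
    (LinearMap.ker f).subtype ∘ₗ p ∘ₗ L + g ∘ₗ R
  have hπ : ∀ v, π v = (p (L v) : M.carrier) + g (R v) := fun v => rfl
  have hL : ∀ x y, L (Fin.append x y) = x := fun x y => by ext1 k; simp [L, LinearMap.funLeft]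
  have hR : ∀ x y, R (Fin.append x y) = y := fun x y => by ext1 k; simp [R, LinearMap.funLeft]
  have hmem : ∀ j v, v ∈ (free (Fin.append deg deg')).hom j ↔
      L v ∈ (free deg).hom j ∧ R v ∈ (free deg').hom j := fun j v => mem_hom_free_append
  have hfp : ∀ x, f (p x : M.carrier) = 0 := fun x => (p x).2
  have hfπ : ∀ v, f (π v) = q (R v) := fun v => by rw [hπ, map_add, hfp, zero_add, hfg]
  refine ⟨b + c, Fin.append deg deg', π, ?_, ⟨?_, ?_, ?_⟩, ?_⟩
  · intro k
    induction k using Fin.addCases with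
    | left l => simpa using hdeg l
    | right l => simpa using hdeg' l
  · intro j v hv
    rw [hmem] at hv
    exact add_mem (hp.isGraded _ _ hv.1) (hg _ _ hv.2)
  · intro m
    obtain ⟨y, hy⟩ := hq.surj (f m)
    obtain ⟨x, hx⟩ := hp.surj ⟨m - g y, by simp [hfg, hy]⟩
    refine ⟨Fin.append x y, ?_⟩
    rw [hπ, hL, hR, hx]
    simp
  · intro j m hm
    obtain ⟨y, hyj, hy⟩ := hq.lift j (f m) (hf.isGraded _ _ hm)
    obtain ⟨x, hxj, hx⟩ := hp.lift j ⟨m - g y, by simp [hfg, hy]⟩ (sub_mem hm (hg _ _ hyj))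
    refine ⟨Fin.append x y, (hmem _ _).2 ⟨by rwa [hL], by rwa [hR]⟩, ?_⟩
    rw [hπ, hL, hR, hx]
    simp
  · let F : (ker π).carrier →ₗ[MvPolynomial σ K] (ker q).carrier :=
      R.restrict fun v hv => by
        rw [LinearMap.mem_ker] at hv ⊢
        rw [← hfπ, hv, map_zero]
    have hF : IsCover F := by
      refine ⟨fun j v hv => ((hmem _ _).1 hv).2, ?_, ?_⟩
      · rintro ⟨y, hy⟩
        obtain ⟨x, hx⟩ := hp.surj ⟨- g y, by simpa [hfg] using hy⟩
        refine ⟨⟨Fin.append x y, ?_⟩, Subtype.ext (hR x y)⟩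
        rw [LinearMap.mem_ker, hπ, hL, hR, hx]
        simp
      · rintro j ⟨y, hy⟩ hyj
        obtain ⟨x, hxj, hx⟩ := hp.lift j ⟨- g y, by simpa [hfg] using hy⟩ (neg_mem (hg _ _ hyj))
        have hxy : Fin.append x y ∈ (GradedMod.free (Fin.append deg deg')).hom j :=
          (hmem _ _).2 ⟨by rwa [hL], by rw [hR]; exact hyj⟩
        refine ⟨⟨Fin.append x y, ?_⟩, hxy, Subtype.ext (hR x y)⟩
        rw [LinearMap.mem_ker, hπ, hL, hR, hx]
        simp
    refine ⟨ker q, F, hF, ?_, hq'⟩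
    let G : (Fin b → MvPolynomial σ K) →ₗ[MvPolynomial σ K] (Fin (b + c) → MvPolynomial σ K) :=
      { toFun := fun x => Fin.append x 0
        map_add' := fun x y => by
          ext1 k
          induction k using Fin.addCases <;> simp
        map_smul' := fun x y => by
          ext1 k
          induction k using Fin.addCases <;> simp }
    have hGπ : ∀ x ∈ LinearMap.ker p, G x ∈ LinearMap.ker π := fun x hx => by
      rw [LinearMap.mem_ker] at hx ⊢
      change (p (L (Fin.append x 0)) : M.carrier) + g (R (Fin.append x 0)) = 0
      rw [hL, hR, hx]
      simp
    let G' : (ker p).carrier →ₗ[MvPolynomial σ K] (ker F).carrier :=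
      (G.restrict hGπ).codRestrict (LinearMap.ker F) fun x => Subtype.ext (hR x.1 0)
    have key : ∀ v : (ker F).carrier, ∃ x : (ker p).carrier, G' x = v := by
      rintro ⟨⟨v, hv⟩, hv'⟩
      have hRv : R v = 0 := congrArg Subtype.val hv'
      refine ⟨⟨L v, ?_⟩, Subtype.ext (Subtype.ext ?_)⟩
      · rw [LinearMap.mem_ker, hπ, hRv, map_zero, add_zero] at hv
        exact Subtype.ext hv
      · change Fin.append (L v) 0 = v
        rw [← hRv]
        exact Fin.append_castAdd_natAdd
    have hG'j : ∀ j x, G' x ∈ (ker F).hom j ↔ x ∈ (ker p).hom j := by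
      intro j x
      change Fin.append x.1 0 ∈ (GradedMod.free (Fin.append deg deg')).hom j ↔
        x.1 ∈ (GradedMod.free deg).hom j
      rw [hmem, hL, hR]
      exact and_iff_left (zero_mem _)
    refine hp'.of_equiv G' ⟨fun j x => (hG'j j x).2, key, ?_⟩ ?_
    · intro j v hv
      obtain ⟨x, rfl⟩ := key v
      exact ⟨x, (hG'j j x).1 hv, rfl⟩
    · intro x y hxy
      have : Fin.append x.1 0 = Fin.append y.1 (0 : Fin c → MvPolynomial σ K) :=
        congrArg (fun z => z.1.1) hxy
      exact Subtype.ext (by rw [← hL x.1 0, this, hL])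

theorem quotient {M N : GradedMod σ K} {r : ℕ} (f : M.carrier →ₗ[MvPolynomial σ K] N.carrier)
    (hf : IsCover f) (hker : RegLE (ker f) (r + 1)) (hM : RegLE M r) : RegLE N r := by
  obtain ⟨b, deg, π, hdeg, hπ, hπ'⟩ := hM.step
  refine of_step ⟨b, deg, f ∘ₗ π, hdeg, ⟨fun j x hx => hf.1 _ _ (hπ.1 _ _ hx),
    hf.2.comp hπ.2, fun j y hy => ?_⟩, ?_⟩
  · obtain ⟨x, hx, rfl⟩ := hf.3 j y hy
    obtain ⟨z, hz, rfl⟩ := hπ.3 j x hx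
    exact ⟨z, hz, rfl⟩
  let F : (ker (f ∘ₗ π)).carrier →ₗ[MvPolynomial σ K] (ker f).carrier :=
    π.restrict fun v hv => hv
  have hF : IsCover F := by
    refine ⟨fun j v hv => hπ.1 _ _ hv, ?_, ?_⟩
    · rintro ⟨y, hy⟩
      obtain ⟨x, rfl⟩ := hπ.2 y
      exact ⟨⟨x, hy⟩, rfl⟩
    · rintro j ⟨y, hy⟩ hyj
      obtain ⟨x, hxj, rfl⟩ := hπ.3 j y hyj
      exact ⟨⟨x, hy⟩, hxj, rfl⟩
  refine extension F hF ?_ hker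
  have hle : ∀ x ∈ LinearMap.ker π, x ∈ LinearMap.ker (f ∘ₗ π) := fun x hx => by
    rw [LinearMap.mem_ker] at hx ⊢
    rw [LinearMap.comp_apply, hx, map_zero]
  let G : (ker π).carrier →ₗ[MvPolynomial σ K] (ker F).carrier :=
    (Submodule.inclusion hle).codRestrict (LinearMap.ker F) fun x => Subtype.ext x.2
  have key : ∀ v : (ker F).carrier, ∃ x : (ker π).carrier, G x = v ∧ x.1 = v.1.1 := by
    rintro ⟨⟨v, hv⟩, hv'⟩
    exact ⟨⟨v, congrArg Subtype.val hv'⟩, rfl, rfl⟩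
  refine hπ'.of_equiv G ⟨fun j x hx => hx, fun v => (key v).imp fun _ h => h.1, ?_⟩ ?_
  · intro j v hv
    obtain ⟨x, hx, hx'⟩ := key v
    refine ⟨x, ?_, hx⟩
    change x.1 ∈ (GradedMod.free deg).hom j
    rw [hx']
    exact hv
  · intro x y hxy
    exact Subtype.ext (congrArg (fun z => z.1.1) hxy)

theorem prod {M N : GradedMod σ K} {r : ℕ} (hM : RegLE M r) (hN : RegLE N r) :
    RegLE (M.prod N) r := by
  let F : (M.prod N).carrier →ₗ[MvPolynomial σ K] N.carrier := LinearMap.snd _ _ _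
  refine extension F ⟨fun j x hx => hx.2, fun y => ⟨(0, y), rfl⟩,
    fun j y hy => ⟨(0, y), ⟨zero_mem _, hy⟩, rfl⟩⟩ ?_ hN
  let G : M.carrier →ₗ[MvPolynomial σ K] (ker F).carrier :=
    (LinearMap.inl _ M.carrier N.carrier).codRestrict (LinearMap.ker F) fun x => rfl
  have key : ∀ v : (ker F).carrier, G v.1.1 = v := by
    rintro ⟨⟨v, w⟩, hw⟩
    exact Subtype.ext (Prod.ext rfl (Eq.symm hw))
  refine hM.of_equiv G ⟨fun j x hx => ⟨hx, zero_mem _⟩, fun v => ⟨_, key v⟩,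
    fun j v hv => ⟨_, hv.1, key v⟩⟩ ?_
  intro x y hxy
  exact congrArg (fun z => z.1.1) hxy

theorem retract {M W : GradedMod σ K} {r : ℕ} (hW : RegLE W r)
    (s : M.carrier →ₗ[MvPolynomial σ K] W.carrier) (p : W.carrier →ₗ[MvPolynomial σ K] M.carrier)
    (hs : IsGraded s) (hp : IsGraded p) (hps : ∀ m, p (s m) = m) : RegLE M r := by
  refine ⟨fun M r => ∃ (W : GradedMod σ K) (s : M.carrier →ₗ[MvPolynomial σ K] W.carrier)
    (p : W.carrier →ₗ[MvPolynomial σ K] M.carrier), RegLE W r ∧ IsGraded s ∧ IsGraded p ∧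
      ∀ m, p (s m) = m, ?_, W, s, p, hW, hs, hp, hps⟩
  clear! M W r
  rintro M r ⟨W, s, p, hW, hs, hp, hps⟩
  obtain ⟨b, deg, q, hdeg, hq, hq'⟩ := hW.step
  refine ⟨b, deg, p ∘ₗ q, hdeg, ⟨fun j x hx => hp _ _ (hq.1 _ _ hx), fun m => ?_,
    fun j m hm => ?_⟩, ?_⟩
  · obtain ⟨x, hx⟩ := hq.2 (s m)
    exact ⟨x, by rw [LinearMap.comp_apply, hx, hps]⟩
  · obtain ⟨x, hxj, hx⟩ := hq.3 j (s m) (hs _ _ hm)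
    exact ⟨x, hxj, by rw [LinearMap.comp_apply, hx, hps]⟩
  let F : GradedMod σ K := GradedMod.free deg
  let D : (F.prod F).carrier →ₗ[MvPolynomial σ K] W.carrier :=
    q ∘ₗ LinearMap.snd _ _ _ - s ∘ₗ p ∘ₗ q ∘ₗ LinearMap.fst _ _ _
  have hD : ∀ x, x ∈ LinearMap.ker D ↔ q x.2 = s (p (q x.1)) := fun x => sub_eq_zero
  let A : (ker D).carrier →ₗ[MvPolynomial σ K] F.carrier :=
    LinearMap.fst _ _ _ ∘ₗ (LinearMap.ker D).subtype
  have hA : IsCover A := by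
    refine ⟨fun j x hx => hx.1, fun x => ?_, fun j x hx => ?_⟩
    · obtain ⟨y, hy⟩ := hq.2 (s (p (q x)))
      exact ⟨⟨(x, y), (hD _).2 hy⟩, rfl⟩
    · obtain ⟨y, hyj, hy⟩ := hq.3 j (s (p (q x))) (hs _ _ (hp _ _ (hq.1 _ _ hx)))
      exact ⟨⟨(x, y), (hD _).2 hy⟩, ⟨hx, hyj⟩, rfl⟩
  have hU : RegLE (ker D) (r + 1) := by
    refine extension A hA ?_ (of_free fun k => (hdeg k).trans r.le_succ)
    have hG : ∀ x ∈ LinearMap.ker q,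
        LinearMap.inr (MvPolynomial σ K) F.carrier F.carrier x ∈ LinearMap.ker D := by
      intro x hx
      rw [hD]
      simpa using hx
    let G : (ker q).carrier →ₗ[MvPolynomial σ K] (ker A).carrier :=
      ((LinearMap.inr _ F.carrier F.carrier).restrict hG).codRestrict (LinearMap.ker A)
        fun x => rfl
    have key : ∀ v : (ker A).carrier, ∃ x : (ker q).carrier, G x = v ∧ x.1 = v.1.1.2 := by
      rintro ⟨⟨⟨v, w⟩, hw⟩, hv⟩
      obtain rfl : v = 0 := hv
      rw [hD] at hw
      refine ⟨⟨w, by simpa using hw⟩, rfl, rfl⟩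
    refine hq'.of_equiv G ⟨fun j x hx => ⟨zero_mem _, hx⟩, fun v => (key v).imp fun _ h => h.1, ?_⟩
      ?_
    · intro j v hv
      obtain ⟨x, hx, hx'⟩ := key v
      refine ⟨x, ?_, hx⟩
      change x.1 ∈ F.hom j
      rw [hx']
      exact hv.2
    · intro x y hxy
      exact Subtype.ext (congrArg (fun z => z.1.1.2) hxy)
  have hi : ∀ x ∈ LinearMap.ker (p ∘ₗ q),
      LinearMap.inl (MvPolynomial σ K) F.carrier F.carrier x ∈ LinearMap.ker D := by
    intro x hx
    rw [LinearMap.mem_ker, LinearMap.comp_apply] at hx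
    rw [hD]
    simp [hx]
  let E : (F.prod F).carrier →ₗ[MvPolynomial σ K] F.carrier :=
    LinearMap.fst _ _ _ - LinearMap.snd _ _ _
  have hE : ∀ x, E x = x.1 - x.2 := fun x => rfl
  have hd : ∀ x ∈ LinearMap.ker D, E x ∈ LinearMap.ker (p ∘ₗ q) := by
    intro x hx
    rw [hD] at hx
    rw [LinearMap.mem_ker, LinearMap.comp_apply, hE, map_sub, hx, map_sub, hps, sub_self]
  exact ⟨ker D, LinearMap.restrict _ hi, E.restrict hd, hU,
    fun j x hx => ⟨hx, zero_mem _⟩, fun j x hx => (F.hom j).sub_mem hx.1 hx.2,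
    fun m => Subtype.ext (sub_zero m.1)⟩

end RegLE

/-- The ideal of polynomials whose monomials lie in the upper set `s`, as a graded module. -/
abbrev monoIdeal (K : Type u) [Field K] {s : Set (σ →₀ ℕ)} (hs : IsUpperSet s) : GradedMod σ K :=
  (poly σ K).sub (restrictSupportIdeal K s hs)

theorem mem_restrictSupportIdeal {s : Set (σ →₀ ℕ)} (hs : IsUpperSet s) {f : MvPolynomial σ K} :
    f ∈ restrictSupportIdeal K s hs ↔ ∀ m, coeff m f ≠ 0 → m ∈ s := by
  change (↑f.support : Set (σ →₀ ℕ)) ⊆ s ↔ _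
  simp [Set.subset_def]

theorem exists_coeff_eq_ite (s : Set (σ →₀ ℕ)) [DecidablePred (· ∈ s)] (f : MvPolynomial σ K) :
    ∃ g : MvPolynomial σ K, ∀ m, coeff m g = if m ∈ s then coeff m f else 0 := by
  classical
  refine ⟨∑ m ∈ f.support with m ∈ s, monomial m (coeff m f), fun m => ?_⟩
  rw [coeff_sum]
  simp only [coeff_monomial, Finset.sum_ite_eq', Finset.mem_filter, mem_support_iff]
  by_cases h : coeff m f = 0 <;> simp [h]

section union

variable {s t : Set (σ →₀ ℕ)} (hs : IsUpperSet s) (ht : IsUpperSet t)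

/-- Addition, from the product of two monomial ideals to their sum. -/
def addMap (K : Type u) [Field K] :
    ((monoIdeal K hs).prod (monoIdeal K ht)).carrier →ₗ[MvPolynomial σ K]
      (monoIdeal K (hs.union ht)).carrier :=
  LinearMap.coprod
    (Submodule.inclusion fun f hf => by
      rw [mem_restrictSupportIdeal] at hf ⊢
      exact fun m hm => Or.inl (hf m hm))
    (Submodule.inclusion fun f hf => by
      rw [mem_restrictSupportIdeal] at hf ⊢
      exact fun m hm => Or.inr (hf m hm))

theorem isCover_addMap : IsCover (addMap hs ht K) := by
  classical
  have key : ∀ y : (monoIdeal K (hs.union ht)).carrier, ∃ x, addMap hs ht K x = y ∧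
      ∀ j, y ∈ (monoIdeal K (hs.union ht)).hom j →
        x ∈ ((monoIdeal K hs).prod (monoIdeal K ht)).hom j := by
    rintro ⟨f, hf⟩
    rw [mem_restrictSupportIdeal] at hf
    obtain ⟨g, hg⟩ := exists_coeff_eq_ite s f
    have hg1 : g ∈ restrictSupportIdeal K s hs := by
      rw [mem_restrictSupportIdeal]
      intro m hm
      by_contra h
      simp [hg, h] at hm
    have hg2 : f - g ∈ restrictSupportIdeal K t ht := by
      rw [mem_restrictSupportIdeal]
      intro m hm
      by_cases h : m ∈ s
      · simp [hg, h] at hm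
      · simp only [coeff_sub, hg, h, if_false, sub_zero] at hm
        exact (hf m hm).resolve_left h
    refine ⟨(⟨g, hg1⟩, ⟨f - g, hg2⟩), Subtype.ext (add_sub_cancel g f), fun j hj => ?_⟩
    have hfj : f.IsHomogeneous j := hj
    have hgj : g.IsHomogeneous j := by
      intro m hm
      rw [hg] at hm
      exact hfj fun h => by simp [h] at hm
    exact ⟨hgj, hfj.sub hgj⟩
  refine ⟨fun j x hx => IsHomogeneous.add hx.1 hx.2, fun y => ?_, fun j y hy => ?_⟩
  · obtain ⟨x, hx, -⟩ := key y
    exact ⟨x, hx⟩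
  · obtain ⟨x, hx, hx'⟩ := key y
    exact ⟨x, hx' j hy, hx⟩

variable {hs ht}

theorem RegLE.ker_addMap {r : ℕ} (h : RegLE (monoIdeal K (hs.inter ht)) r) :
    RegLE (ker (addMap hs ht K)) r := by
  have h1 : ∀ f ∈ restrictSupportIdeal K (s ∩ t) (hs.inter ht), f ∈ restrictSupportIdeal K s hs :=
    fun f hf => by
      rw [mem_restrictSupportIdeal] at hf ⊢
      exact fun m hm => (hf m hm).1
  have h2 : ∀ f ∈ restrictSupportIdeal K (s ∩ t) (hs.inter ht), f ∈ restrictSupportIdeal K t ht :=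
    fun f hf => by
      rw [mem_restrictSupportIdeal] at hf ⊢
      exact fun m hm => (hf m hm).2
  let G : (monoIdeal K (hs.inter ht)).carrier →ₗ[MvPolynomial σ K] (ker (addMap hs ht K)).carrier :=
    ((Submodule.inclusion h1).prod (-Submodule.inclusion h2)).codRestrict _
      fun f => Subtype.ext (add_neg_cancel f.1)
  have key : ∀ y : (ker (addMap hs ht K)).carrier, ∃ x, G x = y ∧ x.1 = y.1.1.1 := by
    rintro ⟨⟨⟨f, hf⟩, ⟨g, hg⟩⟩, hfg⟩
    have hfg : f + g = 0 := congrArg Subtype.val hfg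
    obtain rfl : g = -f := (neg_eq_of_add_eq_zero_right hfg).symm
    refine ⟨⟨f, ?_⟩, rfl, rfl⟩
    have hg := neg_mem hg
    rw [neg_neg] at hg
    rw [mem_restrictSupportIdeal] at hf hg ⊢
    exact fun m hm => ⟨hf m hm, hg m hm⟩
  refine h.of_equiv G ⟨fun j x hx => ⟨hx, neg_mem (S := AddSubgroup _) hx⟩,
    fun y => (key y).imp fun _ h => h.1, fun j y hy => ?_⟩ fun x y hxy => ?_
  · obtain ⟨x, hx, hx'⟩ := key y
    refine ⟨x, ?_, hx⟩
    change x.1 ∈ (poly σ K).hom j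
    rw [hx']
    exact hy.1
  · exact Subtype.ext (congrArg (fun z => z.1.1.1) hxy)

theorem RegLE.union {r : ℕ} (h1 : RegLE (monoIdeal K hs) r) (h2 : RegLE (monoIdeal K ht) r)
    (h : RegLE (monoIdeal K (hs.inter ht)) (r + 1)) : RegLE (monoIdeal K (hs.union ht)) r :=
  quotient _ (isCover_addMap hs ht) h.ker_addMap (h1.prod h2)

theorem RegLE.left_of_union {r : ℕ} (h : RegLE (monoIdeal K (hs.inter ht)) r)
    (hu : RegLE (monoIdeal K (hs.union ht)) r) : RegLE (monoIdeal K hs) r :=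
  retract (extension _ (isCover_addMap hs ht) h.ker_addMap hu)
    (LinearMap.inl _ _ _) (LinearMap.fst _ _ _) (fun _ _ hx => ⟨hx, zero_mem _⟩)
    (fun _ _ hx => hx.1) fun _ => rfl

end union

theorem regLE_Ici (m : σ →₀ ℕ) : RegLE (monoIdeal K (isUpperSet_Ici m)) m.degree := by
  have hmem : ∀ f : MvPolynomial σ K, f * monomial m 1 ∈
      restrictSupportIdeal K (Set.Ici m) (isUpperSet_Ici m) := by
    intro f
    rw [mem_restrictSupportIdeal]
    intro a ha
    by_contra h
    rw [coeff_mul_monomial', if_neg (show ¬m ≤ a from h)] at ha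
    exact ha rfl
  let π : (free (fun _ : Fin 1 => m.degree)).carrier →ₗ[MvPolynomial σ K]
      (monoIdeal K (isUpperSet_Ici m)).carrier :=
    { toFun := fun v => ⟨v 0 * monomial m 1, hmem _⟩
      map_add' := fun v w => Subtype.ext (add_mul _ _ _)
      map_smul' := fun c v => Subtype.ext (mul_assoc _ _ _) }
  have key : ∀ y : (monoIdeal K (isUpperSet_Ici m)).carrier, ∃ x, π x = y ∧
      ∀ j, y ∈ (monoIdeal K (isUpperSet_Ici m)).hom j →
        x ∈ (free (fun _ : Fin 1 => m.degree)).hom j := by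
    rintro ⟨f, hf⟩
    rw [mem_restrictSupportIdeal] at hf
    have hfm : f.divMonomial m * monomial m 1 = f := by
      ext a
      rw [coeff_mul_monomial']
      split_ifs with h
      · rw [coeff_divMonomial, add_tsub_cancel_of_le h, mul_one]
      · by_contra h'
        exact h (hf a (Ne.symm h'))
    refine ⟨fun _ => f.divMonomial m, Subtype.ext hfm, fun j hj => ?_⟩
    rw [mem_hom_free]
    intro _
    by_cases h0 : f.divMonomial m = 0
    · exact Or.inl h0
    have hfj : f.IsHomogeneous j := hj
    have hdeg : ∀ a, coeff a (f.divMonomial m) ≠ 0 → m.degree + a.degree = j := by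
      intro a ha
      rw [coeff_divMonomial] at ha
      rw [← map_add, Finsupp.degree_eq_weight_one]
      exact hfj ha
    obtain ⟨a, ha⟩ := ne_zero_iff.1 h0
    refine Or.inr ⟨a.degree, hdeg a ha, fun c hc => ?_⟩
    have h1 := hdeg a ha
    have h2 := hdeg c hc
    have h3 : Finsupp.weight 1 c = c.degree :=
      (DFunLike.congr_fun Finsupp.degree_eq_weight_one c).symm
    omega
  refine RegLE.of_free_equiv (fun _ => le_rfl) π ⟨isGraded_free fun _ => ?_,
    fun y => (key y).imp fun _ h => h.1, fun j y hy => ?_⟩ fun v w hvw => ?_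
  · change ((Pi.single _ 1 : Fin 1 → MvPolynomial σ K) 0 * monomial m 1).IsHomogeneous _
    rw [Subsingleton.elim 0 _, Pi.single_eq_same, one_mul]
    exact isHomogeneous_monomial _ rfl
  · obtain ⟨x, hx, hx'⟩ := key y
    exact ⟨x, hx' j hy, hx⟩
  · have h : v 0 * monomial m 1 = w 0 * monomial m 1 := congrArg Subtype.val hvw
    have hm : (monomial m (1 : K)) ≠ 0 := by simp
    ext1 k
    rw [Subsingleton.elim k 0]
    exact mul_right_cancel₀ hm h

theorem isUpperSet_exists_le (m : σ →₀ ℕ) (T : Finset σ) :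
    IsUpperSet {a : σ →₀ ℕ | ∃ i ∈ T, m + Finsupp.single i 1 ≤ a} := by
  rintro a b hab ⟨i, hi, h⟩
  exact ⟨i, hi, h.trans hab⟩

theorem regLE_congr {s t : Set (σ →₀ ℕ)} (hs : IsUpperSet s) (ht : IsUpperSet t) (h : s = t)
    {r : ℕ} : RegLE (monoIdeal K hs) r ↔ RegLE (monoIdeal K ht) r := by
  subst h
  rfl

theorem regLE_variables (m : σ →₀ ℕ) (T : Finset σ) :
    RegLE (monoIdeal K (isUpperSet_exists_le m T)) (m.degree + 1) := by
  classical
  induction T using Finset.induction_on generalizing m with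
  | empty =>
    have : Subsingleton (monoIdeal K (isUpperSet_exists_le m ∅)).carrier := by
      refine subsingleton_of_forall_eq 0 fun f => Subtype.ext ?_
      have hf := (mem_restrictSupportIdeal _).1 f.2
      ext a
      by_contra h
      simpa using hf a h
    exact .of_subsingleton _ _
  | insert y T hy ih =>
    have h1 := regLE_Ici (K := K) (m + Finsupp.single y 1)
    have h2 := ih (m + Finsupp.single y 1)
    rw [map_add, Finsupp.degree_single] at h1 h2
    rw [regLE_congr (t := _ ∩ _) _
      ((isUpperSet_exists_le m T).inter (isUpperSet_Ici (m + Finsupp.single y 1)))] at h2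
    · rw [regLE_congr (t := _ ∪ _) _
        ((isUpperSet_exists_le m T).union (isUpperSet_Ici (m + Finsupp.single y 1)))]
      · exact (ih m).union h1 h2
      · ext a
        simp [or_comm]
    · ext a
      simp only [Set.mem_ofPred_eq, Set.mem_inter_iff, Set.mem_Ici]
      constructor
      · rintro ⟨i, hi, h⟩
        refine ⟨⟨i, hi, le_trans ?_ h⟩, le_trans ?_ h⟩
        · gcongr
          simp
        · simp
      · rintro ⟨⟨i, hi, h⟩, h'⟩
        refine ⟨i, hi, fun k => ?_⟩
        have hk := h k
        have hk' := h' k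
        have hiy : i ≠ y := fun h => hy (h ▸ hi)
        simp only [Finsupp.add_apply, Finsupp.single_apply] at hk hk' ⊢
        split_ifs at * <;> simp_all

/-- Projections to the homogeneous elements of each degree. -/
def IsDecomposition {N : GradedMod σ K} (c : ℕ → N.carrier →+ N.carrier) : Prop :=
  ∀ i j, ∀ x ∈ N.hom i, c j x = if j = i then x else 0

theorem exists_isDecomposition_poly :
    ∃ c : ℕ → (poly σ K).carrier →+ (poly σ K).carrier, IsDecomposition c :=
  ⟨fun j => (homogeneousComponent j).toAddMonoidHom, fun _ _ _ hx => homogeneousComponent_of_mem hx⟩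

theorem exists_isDecomposition_free {b : ℕ} (deg : Fin b → ℕ) :
    ∃ c : ℕ → (free (σ := σ) (K := K) deg).carrier →+ (free (σ := σ) (K := K) deg).carrier,
      IsDecomposition c := by
  refine ⟨fun j =>
    { toFun := fun v l => if deg l ≤ j then homogeneousComponent (j - deg l) (v l) else 0
      map_zero' := funext fun l => by
        change (if _ then homogeneousComponent _ (0 : MvPolynomial σ K) else 0) = 0
        rw [map_zero, ite_self]
      map_add' := fun v w => funext fun l => by
        change (if _ then homogeneousComponent _ (v l + w l) else 0) =
          (if _ then _ else _) + ite _ _ _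
        split_ifs
        · exact map_add _ _ _
        · exact (add_zero 0).symm }, fun i j x hx => ?_⟩
  ext1 l
  change (if deg l ≤ j then homogeneousComponent (j - deg l) (x l) else 0) = _
  rcases hx l with h | ⟨e, rfl, h⟩
  · rw [h, map_zero, ite_self]
    split_ifs
    · exact h.symm
    · rfl
  · by_cases hj : deg l ≤ j
    · rw [if_pos hj, homogeneousComponent_of_mem h]
      by_cases hj' : j = deg l + e
      · rw [if_pos (by omega), if_pos hj']
      · rw [if_neg (by omega), if_neg hj']
        rfl
    · rw [if_neg hj, if_neg (by omega)]
      rfl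

theorem exists_hom_of_mem_range {b : ℕ} {deg : Fin b → ℕ} {N : GradedMod σ K}
    {c : ℕ → N.carrier →+ N.carrier} (hc : IsDecomposition c)
    {f : (free deg).carrier →ₗ[MvPolynomial σ K] N.carrier} (hf : IsGraded f)
    {j : ℕ} {y : N.carrier} (hy : y ∈ N.hom j) (hyf : y ∈ LinearMap.range f) :
    ∃ x ∈ (free deg).hom j, f x = y := by
  let A : AddSubmonoid (free (σ := σ) (K := K) deg).carrier :=
    { carrier := {x | ∃ x' ∈ (free deg).hom j, f x' = c j (f x)}
      zero_mem' := ⟨0, zero_mem _, by simp⟩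
      add_mem' := by
        rintro x y ⟨x', hx', hx⟩ ⟨y', hy', hy⟩
        exact ⟨x' + y', add_mem hx' hy', by rw [map_add, map_add, map_add, hx, hy]⟩ }
  have hA : ∀ i, ∀ x ∈ (free deg).hom i, x ∈ A := by
    intro i x hx
    have := hc i j (f x) (hf i x hx)
    by_cases h : j = i
    · subst h
      exact ⟨x, hx, by rw [this, if_pos rfl]⟩
    · exact ⟨0, zero_mem _, by rw [this, if_neg h, map_zero]⟩
  have htop : ∀ x, x ∈ A := by
    intro x
    have hx : x = ∑ k, ∑ i ∈ Finset.range ((x k).totalDegree + 1),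
        homogeneousComponent i (x k) • (Pi.single k 1 : Fin b → MvPolynomial σ K) := by
      have := map_free_eq_sum (free deg) LinearMap.id x
      simp only [LinearMap.id_apply] at this
      refine this.trans (Finset.sum_congr rfl fun k _ => ?_)
      rw [← Finset.sum_smul, sum_homogeneousComponent]
    rw [hx]
    exact A.sum_mem fun k _ => A.sum_mem fun i _ => hA _ _ <|
      (free deg).smul_mem (homogeneousComponent_isHomogeneous i _) (single_mem_hom_free deg k)
  obtain ⟨z, rfl⟩ := hyf
  obtain ⟨x, hx, hxz⟩ := htop z
  exact ⟨x, hx, by rw [hxz, hc j j _ hy, if_pos rfl]⟩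

theorem regLE_of_resolution {I : Ideal (MvPolynomial σ K)} {r : ℕ} {b : ℕ → ℕ}
    {deg : (i : ℕ) → Fin (b i) → ℕ}
    {aug : (Fin (b 0) → MvPolynomial σ K) →ₗ[MvPolynomial σ K] MvPolynomial σ K}
    {d : (i : ℕ) → ((Fin (b (i + 1)) → MvPolynomial σ K) →ₗ[MvPolynomial σ K]
      (Fin (b i) → MvPolynomial σ K))}
    (h : IsGradedFreeResolution I b deg aug d) (hr : ∀ i k, deg i k ≤ r + i) :
    RegLE ((poly σ K).sub I) r := by
  obtain ⟨h1, h2, h3, h4, h5⟩ := h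
  refine ⟨fun N s => ∃ i, s = r + i ∧ ∃ φ : (free (deg i)).carrier →ₗ[MvPolynomial σ K] N.carrier,
    IsCover φ ∧ LinearMap.ker φ = LinearMap.range (d i), ?_, 0, rfl, ?_⟩
  · rintro N _ ⟨i, rfl, φ, hφ, hφd⟩
    refine ⟨b i, deg i, φ, hr i, hφ, i + 1, rfl, ?_⟩
    have hd : ∀ x, d i x ∈ LinearMap.ker φ := fun x => hφd ▸ LinearMap.mem_range_self _ x
    have hdg : IsGraded (M := free (deg (i + 1))) (N := free (deg i)) (d i) :=
      isGraded_free fun k l => h3 i k l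
    refine ⟨(d i).codRestrict (LinearMap.ker φ) hd, ⟨fun j x hx => hdg j x hx, ?_, ?_⟩, ?_⟩
    · rintro ⟨y, hy⟩
      rw [hφd] at hy
      obtain ⟨x, rfl⟩ := hy
      exact ⟨x, rfl⟩
    · rintro j ⟨y, hy⟩ hyj
      obtain ⟨c, hc⟩ := exists_isDecomposition_free (σ := σ) (K := K) (deg i)
      obtain ⟨x, hx, rfl⟩ := exists_hom_of_mem_range hc hdg hyj (hφd ▸ hy)
      exact ⟨x, hx, rfl⟩
    · rw [LinearMap.ker_codRestrict, h5]
  · have hI : ∀ x, aug x ∈ I := fun x => h1 ▸ LinearMap.mem_range_self _ x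
    have hg : IsGraded (M := free (deg 0)) (N := poly σ K) aug := isGraded_free h2
    refine ⟨aug.codRestrict I hI, ⟨fun j x hx => hg j x hx, ?_, ?_⟩, ?_⟩
    · rintro ⟨y, hy⟩
      rw [← h1] at hy
      obtain ⟨x, rfl⟩ := hy
      exact ⟨x, rfl⟩
    · rintro j ⟨y, hy⟩ hyj
      obtain ⟨c, hc⟩ := exists_isDecomposition_poly (σ := σ) (K := K)
      obtain ⟨x, hx, rfl⟩ := exists_hom_of_mem_range hc hg hyj (h1 ▸ hy)
      exact ⟨x, hx, rfl⟩
    · rw [LinearMap.ker_codRestrict, h4]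

/-- Graded modules with a bound on the degrees in a resolution. -/
abbrev RegBounded (σ : Type) (K : Type u) [Field K] :=
  {p : GradedMod σ K × ℕ // RegLE p.1 p.2}

namespace RegBounded

variable (x : RegBounded σ K)

/-- The rank of a chosen free cover. -/
def rank : ℕ := x.2.step.choose

/-- The degrees of the generators of a chosen free cover. -/
def deg : Fin x.rank → ℕ := x.2.step.choose_spec.choose

/-- A chosen free cover. -/
def cover : (Fin x.rank → MvPolynomial σ K) →ₗ[MvPolynomial σ K] x.1.1.carrier :=
  x.2.step.choose_spec.choose_spec.choose

theorem cover_spec : (∀ k, x.deg k ≤ x.1.2) ∧ IsCover (M := free x.deg) x.cover ∧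
    RegLE (ker (M := free x.deg) x.cover) (x.1.2 + 1) :=
  x.2.step.choose_spec.choose_spec.choose_spec

/-- The kernel of the chosen free cover. -/
def next : RegBounded σ K :=
  ⟨(ker (M := free x.deg) x.cover, x.1.2 + 1), x.cover_spec.2.2⟩

/-- The iterated kernels of the chosen free covers. -/
def syzygy : ℕ → RegBounded σ K
  | 0 => x
  | i + 1 => (syzygy i).next

theorem syzygy_snd (i : ℕ) : (x.syzygy i).1.2 = x.1.2 + i := by
  induction i with
  | zero => rfl
  | succ i ih =>
    change (x.syzygy i).1.2 + 1 = _
    omega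

/-- The differential of the free resolution obtained by splicing the chosen free covers. -/
def diff (i : ℕ) : (Fin (x.syzygy (i + 1)).rank → MvPolynomial σ K) →ₗ[MvPolynomial σ K]
    (Fin (x.syzygy i).rank → MvPolynomial σ K) :=
  (LinearMap.ker (x.syzygy i).cover).subtype ∘ₗ (x.syzygy (i + 1)).cover

theorem ker_diff (i : ℕ) : LinearMap.ker (x.diff i) = LinearMap.ker (x.syzygy (i + 1)).cover :=
  LinearMap.ker_comp_of_ker_eq_bot _ (Submodule.ker_subtype _)

theorem range_diff (i : ℕ) : LinearMap.range (x.diff i) = LinearMap.ker (x.syzygy i).cover := by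
  exact (LinearMap.range_comp_of_range_eq_top _ <|
    LinearMap.range_eq_top.2 (x.syzygy (i + 1)).cover_spec.2.1.surj).trans
      (Submodule.range_subtype _)

end RegBounded

theorem exists_resolution_iff {I : Ideal (MvPolynomial σ K)} {r : ℕ} :
    (∃ b deg aug d, IsGradedFreeResolution I b deg aug d ∧ ∀ i k, deg i k ≤ r + i) ↔
      RegLE ((poly σ K).sub I) r := by
  constructor
  · rintro ⟨b, deg, aug, d, h, hr⟩
    exact regLE_of_resolution h hr
  intro h
  let x : RegBounded σ K := ⟨((poly σ K).sub I, r), h⟩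
  let aug : (Fin x.rank → MvPolynomial σ K) →ₗ[MvPolynomial σ K] MvPolynomial σ K :=
    I.subtype ∘ₗ x.cover
  refine ⟨fun i => (x.syzygy i).rank, fun i => (x.syzygy i).deg, aug, x.diff,
    ⟨?_, fun k => ?_, fun i k => ?_, ?_, fun i => ?_⟩, fun i k => ?_⟩
  · exact (LinearMap.range_comp_of_range_eq_top _ <|
      LinearMap.range_eq_top.2 x.cover_spec.2.1.surj).trans (Submodule.range_subtype I)
  · exact x.cover_spec.2.1.isGraded _ _ (single_mem_hom_free x.deg k)
  · exact (x.syzygy (i + 1)).cover_spec.2.1.isGraded _ _ (single_mem_hom_free _ k)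
  · rw [x.range_diff 0]
    exact LinearMap.ker_comp_of_ker_eq_bot _ (Submodule.ker_subtype I)
  · rw [x.ker_diff, x.range_diff]
  · rw [← x.syzygy_snd]
    exact (x.syzygy i).cover_spec.1 k

theorem idealReg_eq (I : Ideal (MvPolynomial σ K)) :
    idealReg I = sInf {r | RegLE ((poly σ K).sub I) r} := by
  simp only [idealReg, exists_resolution_iff]

theorem le_of_regLE {s : Set (σ →₀ ℕ)} {hs : IsUpperSet s} {q r : ℕ}
    (hq : ∀ m ∈ s, q ≤ m.degree) (hne : s.Nonempty) (h : RegLE (monoIdeal K hs) r) : q ≤ r := by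
  obtain ⟨b, deg, π, hdeg, hπ, -⟩ := h.step
  by_contra! hr
  have hz : ∀ k, π (Pi.single k 1 : Fin b → MvPolynomial σ K) = 0 := by
    intro k
    have hk : (π (Pi.single k 1 : Fin b → MvPolynomial σ K)).1.IsHomogeneous (deg k) :=
      hπ.isGraded _ _ (single_mem_hom_free deg k)
    refine Subtype.ext (MvPolynomial.ext _ _ fun m => ?_)
    by_contra hm
    have h1 := hq m ((mem_restrictSupportIdeal hs).1 (π _).2 m hm)
    have h2 : m.degree = deg k := (DFunLike.congr_fun Finsupp.degree_eq_weight_one m).trans (hk hm)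
    have h3 := hdeg k
    omega
  obtain ⟨m, hm⟩ := hne
  have hmem : monomial m (1 : K) ∈ restrictSupportIdeal K s hs := by
    classical
    rw [mem_restrictSupportIdeal]
    intro a ha
    rw [coeff_monomial] at ha
    rwa [← show m = a by by_contra h; exact ha (if_neg h)]
  obtain ⟨v, hv⟩ := hπ.surj ⟨_, hmem⟩
  have h0 : π v = 0 := (map_free_eq_sum _ π v).trans <|
    Finset.sum_eq_zero fun k _ => by rw [hz, smul_zero]
  rw [h0] at hv
  have : (0 : MvPolynomial σ K) = monomial m 1 := congrArg Subtype.val hv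
  exact one_ne_zero (monomial_eq_zero.1 this.symm)

end GradedMod

section flip

variable {n : ℕ}

/-- The exponents of the monomials divisible by `x_F` for some circuit `F`. -/
def circuitSet (C : Finset (Finset (Fin n))) : Set (Fin n →₀ ℕ) :=
  {m | ∃ F ∈ C, F ⊆ m.support}

theorem isUpperSet_circuitSet (C : Finset (Finset (Fin n))) : IsUpperSet (circuitSet C) := by
  rintro a b hab ⟨F, hF, h⟩
  exact ⟨F, hF, h.trans (Finsupp.support_mono hab)⟩

theorem sum_single_one_le_iff (F : Finset (Fin n)) (m : Fin n →₀ ℕ) :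
    ∑ i ∈ F, Finsupp.single i 1 ≤ m ↔ F ⊆ m.support := by
  constructor
  · intro h i hi
    have := h i
    simp only [Finsupp.finsetSum_apply, Finsupp.single_apply, Finset.sum_ite_eq', hi,
      if_true] at this
    simp only [Finsupp.mem_support_iff]
    omega
  · intro h i
    simp only [Finsupp.finsetSum_apply, Finsupp.single_apply, Finset.sum_ite_eq']
    split_ifs with hi
    · exact Nat.one_le_iff_ne_zero.2 (Finsupp.mem_support_iff.1 (h hi))
    · exact Nat.zero_le _

theorem circuitIdeal_eq {K : Type*} [Field K] (C : Finset (Finset (Fin n))) :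
    circuitIdeal K C = restrictSupportIdeal K _ (isUpperSet_circuitSet C) := by
  have h : (fun F : Finset (Fin n) => ∏ i ∈ F, (X i : MvPolynomial (Fin n) K)) =
      fun F => monomial (∑ i ∈ F, Finsupp.single i 1) 1 := by
    ext1 F
    rw [monomial_sum_one]
    rfl
  ext f
  rw [circuitIdeal, h, ← Set.image_image (fun m => monomial m (1 : K)),
    mem_ideal_span_monomial_image, GradedMod.mem_restrictSupportIdeal]
  simp [circuitSet, sum_single_one_le_iff]

theorem le_degree_of_mem_circuitSet {C : Finset (Finset (Fin n))} {q : ℕ}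
    (hC : ∀ F ∈ C, F.card = q) {m : Fin n →₀ ℕ} (hm : m ∈ circuitSet C) : q ≤ m.degree := by
  obtain ⟨F, hF, h⟩ := hm
  rw [← hC F hF, Finsupp.degree_apply]
  refine (Finset.card_le_card h).trans ?_
  rw [Finset.card_eq_sum_ones]
  exact Finset.sum_le_sum fun i hi => Nat.one_le_iff_ne_zero.2 (Finsupp.mem_support_iff.1 hi)

theorem card_clutterCompl {d : ℕ} {C : Finset (Finset (Fin n))} :
    ∀ F ∈ clutterCompl d C, F.card = d := by
  intro F hF
  simp only [clutterCompl, Finset.mem_sdiff, Finset.mem_powersetCard] at hF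
  exact hF.1.2

theorem mem_clutterCompl_triple {C : Finset (Finset (Fin n))} {x y z : Fin n} (hxy : x ≠ y)
    (hxz : x ≠ z) (hyz : y ≠ z) : {x, y, z} ∈ clutterCompl 3 C ↔ {x, y, z} ∉ C := by
  simp [clutterCompl, Finset.mem_powersetCard, Finset.card_eq_three.2 ⟨x, y, z, hxy, hxz, hyz, rfl⟩]

theorem subset_support_of_le {c d : Fin n} (hcd : c ≠ d) (T : Finset (Fin n)) (hT : c ∉ T ∧ d ∉ T) :
    {m : Fin n →₀ ℕ | ∃ i ∈ T, Finsupp.single c 1 + Finsupp.single d 1 + Finsupp.single i 1 ≤ m} =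
      {m | ∃ i ∈ T, {c, d, i} ⊆ m.support} := by
  ext m
  refine exists_congr fun i => and_congr_right fun hi => ?_
  have hci : c ≠ i := fun h => hT.1 (h ▸ hi)
  have hdi : d ≠ i := fun h => hT.2 (h ▸ hi)
  rw [← sum_single_one_le_iff, Finset.sum_insert (by simp [hcd, hci]),
    Finset.sum_insert (by simp [hdi]), Finset.sum_singleton, add_assoc]

theorem regLE_support {K : Type*} [Field K] {c d : Fin n} (hcd : c ≠ d)
    (T : Finset (Fin n)) (hT : c ∉ T ∧ d ∉ T)
    (hs : IsUpperSet {m : Fin n →₀ ℕ | ∃ i ∈ T, {c, d, i} ⊆ m.support}) :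
    GradedMod.RegLE (GradedMod.monoIdeal K hs) 3 := by
  have h := GradedMod.regLE_variables (K := K) (Finsupp.single c 1 + Finsupp.single d 1) T
  rw [map_add, Finsupp.degree_single, Finsupp.degree_single] at h
  exact (GradedMod.regLE_congr _ _ (subset_support_of_le hcd T hT)).1 h

theorem triple_rotate {α : Type*} [DecidableEq α] (x y z : α) :
    ({x, y, z} : Finset α) = {y, z, x} := by
  rw [Finset.insert_comm, Finset.pair_comm]

theorem eq_triple_of_subset {α : Type*} [DecidableEq α] {a b c d : α} (hab : a ≠ b) (hac : a ≠ c)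
    (had : a ≠ d) (hbc : b ≠ c) (hbd : b ≠ d) (hcd : c ≠ d) {F : Finset α} (hF : F.card = 3)
    (hsub : F ⊆ {a, b, c, d}) :
    F = {b, c, d} ∨ F = {a, c, d} ∨ F = {a, b, d} ∨ F = {a, b, c} := by
  have hcard : ({a, b, c, d} : Finset α).card = 4 := by simp [*]
  obtain ⟨x, hx⟩ : ∃ x, ({a, b, c, d} : Finset α) \ F = {x} := by
    rw [← Finset.card_eq_one, Finset.card_sdiff_of_subset hsub, hcard, hF]
  have hFx : F = ({a, b, c, d} : Finset α).erase x := by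
    rw [Finset.erase_eq, ← hx, Finset.sdiff_sdiff_eq_self hsub]
  have hxm : x ∈ ({a, b, c, d} : Finset α) :=
    (Finset.mem_sdiff.1 (hx ▸ Finset.mem_singleton_self x)).1
  clear hx hsub hcard hF
  simp only [Finset.mem_insert, Finset.mem_singleton] at hxm
  subst hFx
  rcases hxm with rfl | rfl | rfl | rfl
  · exact Or.inl (Finset.erase_insert (by simp [*]))
  · refine Or.inr (Or.inl ?_)
    rw [Finset.erase_insert_of_ne hab, Finset.erase_insert (by simp [*])]
  · refine Or.inr (Or.inr (Or.inl ?_))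
    rw [Finset.erase_insert_of_ne hac, Finset.erase_insert_of_ne hbc,
      Finset.erase_insert (by simp [*])]
  · refine Or.inr (Or.inr (Or.inr ?_))
    rw [Finset.erase_insert_of_ne had, Finset.erase_insert_of_ne hbd,
      Finset.erase_insert_of_ne hcd, Finset.erase_singleton, insert_empty_eq]

/-- If `D` consists of the triples of `C` and the faces `{a, c, d}`, `{b, c, d}` of a tetrahedron
whose edge `{a, b}` lies in no other triple of `C`, and `{c, d}` in none, then the complementary
circuit ideals of `C` and `D` have the same regularity bounds from `3` on. -/
theorem regLE_clutterCompl_iff {K : Type*} [Field K] {C D : Finset (Finset (Fin n))}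
    {a b c d : Fin n} (hab : a ≠ b) (hac : a ≠ c) (had : a ≠ d) (hbc : b ≠ c) (hbd : b ≠ d)
    (hcd : c ≠ d) (habc : {a, b, c} ∈ C) (habd : {a, b, d} ∈ C)
    (hno : ∀ F ∈ C, ¬ ({c, d} : Finset (Fin n)) ⊆ F)
    (hD : D = C ∪ {{a, c, d}, {b, c, d}}) {r : ℕ} (hr : 3 ≤ r) :
    GradedMod.RegLE (GradedMod.monoIdeal K (isUpperSet_circuitSet (clutterCompl 3 D))) r ↔
      GradedMod.RegLE (GradedMod.monoIdeal K (isUpperSet_circuitSet (clutterCompl 3 C))) r := by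
  have hcdC : ∀ i, {c, d, i} ∉ C := fun i hi =>
    hno _ hi (triple_rotate i c d ▸ Finset.subset_insert _ _)
  let T : Finset (Fin n) := Finset.univ \ {c, d}
  let U : Finset (Fin n) := Finset.univ \ {a, b, c, d}
  have hT : ∀ i, i ∈ T ↔ i ≠ c ∧ i ≠ d := fun i => by simp [T]
  have hU : ∀ i, i ∈ U ↔ i ≠ a ∧ i ≠ b ∧ i ≠ c ∧ i ≠ d := fun i => by simp [U]
  have hup : ∀ V : Finset (Fin n),
      IsUpperSet {m : Fin n →₀ ℕ | ∃ i ∈ V, {c, d, i} ⊆ m.support} := by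
    rintro V x y hxy ⟨i, hi, h⟩
    exact ⟨i, hi, h.trans (Finsupp.support_mono hxy)⟩
  have hL := isUpperSet_circuitSet (clutterCompl 3 D)
  have hTr := (regLE_support (K := K) hcd T ⟨by simp [hT], by simp [hT]⟩ (hup T)).mono hr
  have hUr := (regLE_support (K := K) hcd U ⟨by simp [hU], by simp [hU]⟩ (hup U)).mono hr
  have hinter : {m : Fin n →₀ ℕ | ∃ i ∈ U, {c, d, i} ⊆ m.support} =
      circuitSet (clutterCompl 3 D) ∩ {m | ∃ i ∈ T, {c, d, i} ⊆ m.support} := by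
    ext m
    constructor
    · rintro ⟨i, hi, him⟩
      rw [hU] at hi
      refine ⟨⟨{c, d, i}, ?_, him⟩, i, (hT i).2 hi.2.2, him⟩
      rw [mem_clutterCompl_triple hcd hi.2.2.1.symm hi.2.2.2.symm, hD]
      simp only [Finset.mem_union, Finset.mem_insert, Finset.mem_singleton, not_or]
      have hi' : i ∈ ({c, d, i} : Finset (Fin n)) := by simp
      refine ⟨hcdC i, fun h => ?_, fun h => ?_⟩
      · rw [h] at hi'
        simp [hi] at hi'
      · rw [h] at hi'
        simp [hi] at hi'
    · rintro ⟨⟨F, hF, hFm⟩, i, hi, him⟩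
      by_contra hcon
      have hsub : F ⊆ {a, b, c, d} := by
        intro x hx
        by_contra h
        simp only [Finset.mem_insert, Finset.mem_singleton, not_or] at h
        refine hcon ⟨x, (hU x).2 h, ?_⟩
        intro y hy
        simp only [Finset.mem_insert, Finset.mem_singleton] at hy
        rcases hy with rfl | rfl | rfl
        · exact him (by simp)
        · exact him (by simp)
        · exact hFm hx
      refine (Finset.mem_sdiff.1 hF).2 ?_
      rw [hD, Finset.mem_union, Finset.mem_insert, Finset.mem_singleton]
      rcases eq_triple_of_subset hab hac had hbc hbd hcd (card_clutterCompl F hF) hsub with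
        rfl | rfl | rfl | rfl
      exacts [Or.inr (Or.inr rfl), Or.inr (Or.inl rfl), Or.inl habd, Or.inl habc]
  have hunion : circuitSet (clutterCompl 3 C) =
      circuitSet (clutterCompl 3 D) ∪ {m | ∃ i ∈ T, {c, d, i} ⊆ m.support} := by
    ext m
    constructor
    · rintro ⟨F, hF, hFm⟩
      by_cases hFD : F ∈ D
      · have hFC := (Finset.mem_sdiff.1 hF).2
        rw [hD, Finset.mem_union, or_iff_right hFC, Finset.mem_insert, Finset.mem_singleton] at hFD
        right
        rcases hFD with rfl | rfl
        · exact ⟨a, (hT a).2 ⟨hac, had⟩, triple_rotate a c d ▸ hFm⟩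
        · exact ⟨b, (hT b).2 ⟨hbc, hbd⟩, triple_rotate b c d ▸ hFm⟩
      · exact Or.inl ⟨F, Finset.mem_sdiff.2 ⟨(Finset.mem_sdiff.1 hF).1, hFD⟩, hFm⟩
    · rintro (⟨F, hF, hFm⟩ | ⟨i, hi, him⟩)
      · refine ⟨F, Finset.mem_sdiff.2 ⟨(Finset.mem_sdiff.1 hF).1, fun h => ?_⟩, hFm⟩
        exact (Finset.mem_sdiff.1 hF).2 (hD ▸ Finset.mem_union_left _ h)
      · rw [hT] at hi
        exact ⟨_, (mem_clutterCompl_triple hcd hi.1.symm hi.2.symm).2 (hcdC i), him⟩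
  rw [GradedMod.regLE_congr (hup U) (hL.inter (hup T)) hinter] at hUr
  rw [GradedMod.regLE_congr _ (hL.union (hup T)) hunion]
  exact ⟨fun h => h.union hTr (hUr.mono r.le_succ),
    fun h => GradedMod.RegLE.left_of_union (ht := hup T) hUr h⟩

theorem le_of_regLE_clutterCompl {K : Type*} [Field K] {C : Finset (Finset (Fin n))} {q r : ℕ}
    (hC : (clutterCompl q C).Nonempty)
    (h : GradedMod.RegLE (GradedMod.monoIdeal K (isUpperSet_circuitSet (clutterCompl q C))) r) :
    q ≤ r := by
  obtain ⟨F, hF⟩ := hC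
  refine GradedMod.le_of_regLE (fun m => le_degree_of_mem_circuitSet card_clutterCompl)
    ⟨∑ i ∈ F, Finsupp.single i 1, F, hF, (sum_single_one_le_iff _ _).1 le_rfl⟩ h

end flip

/-- Let `C` be a 3-uniform clutter on `[n]` and `C'` a flip of `C`:
for some pairwise distinct vertices `a, b, c, d`, the circuits `{a,b,c}, {a,b,d}` are the
only circuits of `C` containing `{a,b}`, no circuit of `C` contains `{c,d}`, and
`C' = (C ∪ {{a,c,d},{b,c,d}}) \ {{a,b,c},{a,b,d}}`.  Then `reg I(C̄) = reg I(C̄')`. -/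
theorem reg_eq_of_flip {K : Type*} [Field K] (n : ℕ)
    (C C' : Finset (Finset (Fin n))) (hunif : ∀ F ∈ C, F.card = 3)
    (hflip : ∃ a b c d : Fin n,
      a ≠ b ∧ a ≠ c ∧ a ≠ d ∧ b ≠ c ∧ b ≠ d ∧ c ≠ d ∧
      ({a, b, c} : Finset (Fin n)) ∈ C ∧ ({a, b, d} : Finset (Fin n)) ∈ C ∧
      (∀ F ∈ C, ({a, b} : Finset (Fin n)) ⊆ F →
        F = ({a, b, c} : Finset (Fin n)) ∨ F = ({a, b, d} : Finset (Fin n))) ∧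
      (∀ F ∈ C, ¬ (({c, d} : Finset (Fin n)) ⊆ F)) ∧
      C' = (C ∪ {({a, c, d} : Finset (Fin n)), ({b, c, d} : Finset (Fin n))}) \
        {({a, b, c} : Finset (Fin n)), ({a, b, d} : Finset (Fin n))}) :
    idealReg (circuitIdeal K (clutterCompl 3 C)) =
      idealReg (circuitIdeal K (clutterCompl 3 C')) := by
  obtain ⟨a, b, c, d, hab, hac, had, hbc, hbd, hcd, habc, habd, honly, hno, hC'⟩ := hflip
  have habF : ∀ F ∈ ({{a, c, d}, {b, c, d}} : Finset (Finset (Fin n))), ¬ {a, b} ⊆ F := by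
    simp [Finset.insert_subset_iff, hab, hac, had, hbc, hbd, hab.symm]
  have hab_sub : ∀ F ∈ ({{a, b, c}, {a, b, d}} : Finset (Finset (Fin n))), {a, b} ⊆ F := by
    simp [Finset.insert_subset_iff]
  have hmem : ∀ F ∈ ({{a, c, d}, {b, c, d}} : Finset (Finset (Fin n))), F ∈ C' := fun F hF => by
    rw [hC']
    exact Finset.mem_sdiff.2 ⟨Finset.mem_union_right _ hF, fun h => habF F hF (hab_sub F h)⟩
  have hacd' : {c, d, a} ∈ C' := triple_rotate a c d ▸ hmem _ (by simp)
  have hbcd' : {c, d, b} ∈ C' := triple_rotate b c d ▸ hmem _ (by simp)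
  have hno' : ∀ F ∈ C', ¬ {a, b} ⊆ F := by
    intro F hF h
    rw [hC', Finset.mem_sdiff, Finset.mem_union] at hF
    rcases hF.1 with hFC | hF'
    · exact hF.2 (by simpa using honly F hFC h)
    · exact habF F hF' h
  have hD : C ∪ {{a, c, d}, {b, c, d}} = C' ∪ {{c, a, b}, {d, a, b}} := by
    rw [triple_rotate c a b, triple_rotate d a b, hC', Finset.sdiff_union_of_subset]
    exact (Finset.insert_subset habc (Finset.singleton_subset_iff.2 habd)).trans
      Finset.subset_union_left
  have hiff : ∀ {r : ℕ}, 3 ≤ r →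
      (GradedMod.RegLE (GradedMod.monoIdeal K (isUpperSet_circuitSet (clutterCompl 3 C))) r ↔
        GradedMod.RegLE (GradedMod.monoIdeal K (isUpperSet_circuitSet (clutterCompl 3 C'))) r) :=
    fun hr => (regLE_clutterCompl_iff hab hac had hbc hbd hcd habc habd hno rfl hr).symm.trans
      (regLE_clutterCompl_iff hcd hac.symm hbc.symm had.symm hbd.symm hab hacd' hbcd' hno' hD hr)
  have hC : (clutterCompl 3 C).Nonempty :=
    ⟨_, (mem_clutterCompl_triple hac had hcd).2 fun h => hno _ h (Finset.subset_insert _ _)⟩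
  have hC'ne : (clutterCompl 3 C').Nonempty :=
    ⟨_, (mem_clutterCompl_triple hab hac hbc).2 fun h => hno' _ h (hab_sub _ (by simp))⟩
  rw [circuitIdeal_eq, circuitIdeal_eq, GradedMod.idealReg_eq, GradedMod.idealReg_eq]
  congr 1
  ext r
  exact ⟨fun h => (hiff (le_of_regLE_clutterCompl hC h)).1 h,
    fun h => (hiff (le_of_regLE_clutterCompl hC'ne h)).2 h⟩
end
end

section
/- Let n ≥ 4, S = K[x_1,…,x_n], and let T_n be the ideal generated by x_4⋯x_n together with the monomials x_1x_2x_3·(x_4⋯x_n)/x_j for j = 4,…,n. Then depth(S/T_n) = n − 2. -/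
open MvPolynomial

noncomputable section

/-- The depth of the module `M` with respect to the ideal `J`: the supremum of the lengths
of `M`-regular sequences consisting of elements of `J`. -/
noncomputable def idealDepth {R : Type*} [CommRing R] (J : Ideal R)
    (M : Type*) [AddCommGroup M] [Module R M] : ℕ :=
  sSup {k : ℕ | ∃ rs : List R, rs.length = k ∧ (∀ r ∈ rs, r ∈ J) ∧
    RingTheory.Sequence.IsRegular M rs}

open CategoryTheory in
/-- For `I` the colon ideal `A : a`, the complex `R ⧸ I → R ⧸ A → R ⧸ (A + (a))` whose first map is
multiplication by `a`. -/
def colonShortComplex {R : Type*} [CommRing R] (I A : Ideal R) (a : R)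
    (h : ∀ x, a * x ∈ A ↔ x ∈ I) : ShortComplex (ModuleCat R) :=
  ModuleCat.shortComplexOfCompEqZero
    (I.mapQ A (LinearMap.mulLeft R a) fun x hx ↦ (h x).2 hx)
    (A.mapQ (A ⊔ Ideal.span {a}) LinearMap.id fun _ hx ↦ Ideal.mem_sup_left hx) <| by
      refine Submodule.linearMap_qext _ (LinearMap.ext fun x ↦ ?_)
      simpa using! (Submodule.Quotient.mk_eq_zero (A ⊔ Ideal.span {a})).2
        (Ideal.mem_sup_right (Ideal.mul_mem_right x _ (Ideal.mem_span_singleton_self a)))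

open CategoryTheory in
lemma colonShortComplex_shortExact {R : Type*} [CommRing R] (I A : Ideal R) (a : R)
    (h : ∀ x, a * x ∈ A ↔ x ∈ I) : (colonShortComplex I A a h).ShortExact where
  exact := ModuleCat.shortComplex_exact _ <| by
    intro y
    obtain ⟨y, rfl⟩ := Submodule.Quotient.mk_surjective _ y
    constructor
    · intro hy
      have hy' : y ∈ A ⊔ Ideal.span {a} := (Submodule.Quotient.mk_eq_zero _).1 hy
      obtain ⟨b, hb, c, hc, rfl⟩ := Submodule.mem_sup.1 hy'
      obtain ⟨x, rfl⟩ := Ideal.mem_span_singleton.1 hc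
      exact ⟨Submodule.Quotient.mk x, (Submodule.Quotient.eq _).2 <| by simpa using! hb⟩
    · rintro ⟨x, hx⟩
      obtain ⟨x, rfl⟩ := Submodule.Quotient.mk_surjective _ x
      rw [← hx]
      exact (Submodule.Quotient.mk_eq_zero (A ⊔ Ideal.span {a})).2
        (Ideal.mem_sup_right (Ideal.mul_mem_right x _ (Ideal.mem_span_singleton_self a)))
  mono_f := by
    rw [ModuleCat.mono_iff_injective]
    refine (injective_iff_map_eq_zero
      (I.mapQ A (LinearMap.mulLeft R a) fun x hx ↦ (h x).2 hx)).2 fun x hx ↦ ?_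
    obtain ⟨x, rfl⟩ := Submodule.Quotient.mk_surjective _ x
    exact (Submodule.Quotient.mk_eq_zero _).2 ((h x).1 ((Submodule.Quotient.mk_eq_zero _).1 hx))
  epi_g := by
    rw [ModuleCat.epi_iff_surjective]
    intro y
    obtain ⟨y, rfl⟩ := Submodule.Quotient.mk_surjective _ y
    exact ⟨Submodule.Quotient.mk y, rfl⟩

open CategoryTheory Abelian in
/-- `Extᶦ(R ⧸ J, R ⧸ I) = 0` for all `i < k`. -/
def ExtQuotientVanishes {R : Type*} [CommRing R] (J I : Ideal R) (k : ℕ) : Prop :=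
  ∀ i < k, Subsingleton (Ext (ModuleCat.of R (R ⧸ J)) (ModuleCat.of R (R ⧸ I)) i)

namespace ExtQuotientVanishes

open CategoryTheory Abelian

variable {R : Type*} [CommRing R] {J I A : Ideal R} {a : R} {k : ℕ}

lemma sup_span_singleton (h : ∀ x, a * x ∈ I → x ∈ I) (H : ExtQuotientVanishes J I (k + 1)) :
    ExtQuotientVanishes J (I ⊔ Ideal.span {a}) k := by
  intro i hi
  have hS := colonShortComplex_shortExact I I a fun x ↦ ⟨h x, I.mul_mem_left a⟩
  have h₁ := H (i + 1) (by omega)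
  have h₂ := H i (by omega)
  refine subsingleton_of_forall_eq 0 fun x ↦ ?_
  obtain ⟨y, rfl⟩ := Ext.covariant_sequence_exact₃ _ hS x rfl (h₁.elim _ _)
  obtain rfl : y = 0 := h₂.elim _ _
  exact map_zero ((Ext.mk₀ _).postcomp _ (add_zero i))

lemma of_colon (h : ∀ x, a * x ∈ A ↔ x ∈ I) (H : ExtQuotientVanishes J I k)
    (H' : ExtQuotientVanishes J (A ⊔ Ideal.span {a}) k) : ExtQuotientVanishes J A k := by
  intro i hi
  have hS := colonShortComplex_shortExact I A a h
  have h₁ := H i hi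
  have h₂ := H' i hi
  refine subsingleton_of_forall_eq 0 fun x ↦ ?_
  obtain ⟨y, rfl⟩ := Ext.covariant_sequence_exact₂ _ hS x (h₂.elim _ _)
  obtain rfl : y = 0 := h₁.elim _ _
  exact map_zero ((Ext.mk₀ _).postcomp _ (add_zero i))

lemma top : ExtQuotientVanishes J (⊤ : Ideal R) k := by
  intro i _
  have h0 : 𝟙 (ModuleCat.of R (R ⧸ (⊤ : Ideal R))) = 0 := by
    ext
    exact Subsingleton.elim (α := R ⧸ (⊤ : Ideal R)) _ _
  refine subsingleton_of_forall_eq 0 fun x ↦ ?_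
  rw [← Ext.comp_mk₀_id x, h0, Ext.mk₀_zero, Ext.comp_zero]

lemma of_isRegular [IsNoetherianRing R] (hJ : J ≠ ⊤) {rs : List R} (mem : ∀ r ∈ rs, r ∈ J)
    (reg : RingTheory.Sequence.IsRegular R rs) :
    ExtQuotientVanishes J (⊥ : Ideal R) rs.length := by
  have e : (R ⧸ (⊥ : Ideal R)) ≃ₗ[R] R := Submodule.quotEquivOfEqBot ⊥ rfl
  refine ModuleCat.subsingleton_ext_of_exists_isRegular J (ModuleCat.of R (R ⧸ J)) ?_
    (ModuleCat.of R (R ⧸ (⊥ : Ideal R))) ?_ rs mem ((e.isRegular_congr rs).2 reg)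
  · change Module.support R (R ⧸ J) ⊆ _
    rw [Module.support_eq_zeroLocus, Ideal.annihilator_quotient]
  · rw [lt_top_iff_ne_top]
    intro h
    have := congrArg (Submodule.map e.toLinearMap) h
    rw [Submodule.map_smul''] at this
    simp [hJ] at this

lemma exists_isRegular [IsNoetherianRing R] (hJ : J ≠ ⊤) (hI : I ≤ J)
    (H : ExtQuotientVanishes J I k) :
    ∃ rs : List R, rs.length = k ∧ (∀ r ∈ rs, r ∈ J) ∧
      RingTheory.Sequence.IsRegular (R ⧸ I) rs := by
  refine ModuleCat.exists_isRegular_of_exists_subsingleton_ext J k (ModuleCat.of R (R ⧸ I)) ?_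
    (ModuleCat.of R (R ⧸ J)) ?_ H
  · rw [lt_top_iff_ne_top]
    intro h
    have := congrArg (Submodule.comap I.mkQ) h
    change Submodule.comap I.mkQ (J • (⊤ : Submodule R (R ⧸ I))) = _ at this
    rw [Submodule.comap_smul_top_of_surjective J _ (Submodule.mkQ_surjective _)] at this
    simp [hI, hJ] at this
  · change Module.support R (R ⧸ J) = _
    rw [Module.support_eq_zeroLocus, Ideal.annihilator_quotient]

end ExtQuotientVanishes

/-- The length of a regular sequence on a module is at most the dimension of its support. -/
lemma RingTheory.Sequence.IsRegular.length_le_supportDim {R M : Type*} [CommRing R]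
    [AddCommGroup M] [Module R M] [IsNoetherianRing R] [Module.Finite R M] {rs : List R}
    (reg : RingTheory.Sequence.IsRegular M rs) : rs.length ≤ Module.supportDim R M := by
  induction rs generalizing M with
  | nil =>
    have := reg.nontrivial
    have := Module.supportDim_ne_bot_of_nontrivial R M
    simpa using! Order.krullDim_nonneg_iff.2 (Order.krullDim_ne_bot_iff.1 this)
  | cons x rs ih =>
    obtain ⟨hx, hrs⟩ := (RingTheory.Sequence.isRegular_cons_iff M x rs).1 reg
    refine le_trans ?_ (Module.supportDim_quotSMulTop_succ_le_of_notMem_minimalPrimes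
      fun _ ↦ hx.notMem_of_mem_minimalPrimes)
    simpa using add_le_add_left (ih hrs) 1

namespace MvPolynomial

variable {σ K : Type*} [Field K]

lemma span_range_X_ne_top :
    Ideal.span (Set.range (X : σ → MvPolynomial σ K)) ≠ ⊤ := by
  rw [← Set.image_univ, Ne, Ideal.eq_top_iff_one, mem_ideal_span_X_image]
  intro h
  simpa using h 0 (by simp)

lemma not_X_dvd_mul_prod {u : MvPolynomial σ K} {s : Finset σ} {a : σ} (ha : a ∉ s)
    (hu : ¬ X a ∣ u) : ¬ X a ∣ u * ∏ i ∈ s, X i := fun h ↦ by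
  obtain h | h := X_prime.dvd_or_dvd h
  · exact hu h
  · obtain ⟨i, hi, h⟩ := X_prime.exists_mem_finset_dvd h
    exact ha (X_dvd_X.1 h ▸ hi)

end MvPolynomial

namespace MvPolynomial

variable {σ K : Type*} [Field K]

/-- The ideal generated by `∏ i ∈ s, Xᵢ` and by `u * ∏ i ∈ s \ {j}, Xᵢ` for `j ∈ s`. -/
def prodEraseIdeal [DecidableEq σ] (u : MvPolynomial σ K) (s : Finset σ) :
    Ideal (MvPolynomial σ K) :=
  Ideal.span ({∏ i ∈ s, X i} ∪ (fun j ↦ u * ∏ i ∈ s.erase j, X i) '' s)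

section prodEraseIdeal

variable [DecidableEq σ] {u : MvPolynomial σ K} {s : Finset σ}

lemma prod_mem_prodEraseIdeal : ∏ i ∈ s, X i ∈ prodEraseIdeal u s :=
  Ideal.subset_span (Or.inl rfl)

lemma mul_prod_erase_mem_prodEraseIdeal {j : σ} (hj : j ∈ s) :
    u * ∏ i ∈ s.erase j, X i ∈ prodEraseIdeal u s :=
  Ideal.subset_span (Or.inr ⟨j, hj, rfl⟩)

lemma prodEraseIdeal_empty : prodEraseIdeal u ∅ = ⊤ :=
  (Ideal.eq_top_iff_one _).2 (by simpa using prod_mem_prodEraseIdeal (u := u) (s := ∅))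

lemma prodEraseIdeal_insert {a : σ} (ha : a ∉ s) :
    prodEraseIdeal u (insert a s) =
      Ideal.span {X a} * prodEraseIdeal u s ⊔ Ideal.span {u * ∏ i ∈ s, X i} := by
  have herase : ∀ j ∈ s, ∏ i ∈ (insert a s).erase j, (X i : MvPolynomial σ K) =
      X a * ∏ i ∈ s.erase j, X i := fun j hj ↦ by
    rw [Finset.erase_insert_of_ne (by rintro rfl; exact ha hj), Finset.prod_insert (by simp [ha])]
  apply le_antisymm
  · refine Ideal.span_le.2 ?_
    rintro _ (rfl | ⟨j, hj, rfl⟩)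
    · rw [Finset.prod_insert ha]
      exact Ideal.mem_sup_left (Ideal.mul_mem_mul (Ideal.mem_span_singleton_self _)
        prod_mem_prodEraseIdeal)
    · obtain rfl | hj := Finset.mem_insert.1 hj
      · simpa [ha] using! Ideal.mem_sup_right (Ideal.mem_span_singleton_self _)
      · simp only [herase j hj, mul_left_comm u]
        exact Ideal.mem_sup_left (Ideal.mul_mem_mul (Ideal.mem_span_singleton_self _)
          (mul_prod_erase_mem_prodEraseIdeal hj))
  · refine sup_le (Ideal.span_singleton_mul_le_iff.2 fun z hz ↦ ?_)
      ((Ideal.span_singleton_le_iff_mem _).2 ?_)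
    · induction hz using Submodule.span_induction with
      | mem z hz =>
        obtain rfl | ⟨j, hj, rfl⟩ := hz
        · rw [← Finset.prod_insert ha]
          exact prod_mem_prodEraseIdeal
        · simp only [mul_left_comm _ u, ← herase j hj]
          exact mul_prod_erase_mem_prodEraseIdeal (Finset.mem_insert_of_mem hj)
      | zero => simp
      | add x y _ _ hx hy => rw [mul_add]; exact add_mem hx hy
      | smul c x _ hx => rw [smul_eq_mul, mul_left_comm]; exact Ideal.mul_mem_left _ _ hx
    · simpa [ha] using mul_prod_erase_mem_prodEraseIdeal (u := u) (Finset.mem_insert_self a s)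

lemma mul_mem_prodEraseIdeal_insert {a : σ} (ha : a ∉ s) (hu : ¬ X a ∣ u)
    (x : MvPolynomial σ K) :
    X a * x ∈ prodEraseIdeal u (insert a s) ↔ x ∈ prodEraseIdeal u s := by
  rw [prodEraseIdeal_insert ha]
  refine ⟨fun h ↦ ?_, fun h ↦ Ideal.mem_sup_left
    (Ideal.mul_mem_mul (Ideal.mem_span_singleton_self _) h)⟩
  obtain ⟨y, hy, z, hz, hxyz⟩ := Submodule.mem_sup.1 h
  obtain ⟨t, ht, rfl⟩ := Ideal.mem_span_singleton_mul.1 hy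
  obtain ⟨c, rfl⟩ := Ideal.mem_span_singleton.1 hz
  have hac : X a ∣ u * (∏ i ∈ s, X i) * c :=
    (dvd_add_right (dvd_mul_right _ t)).1 (hxyz ▸ dvd_mul_right _ x)
  obtain ⟨c, rfl⟩ := (X_prime.dvd_or_dvd hac).resolve_left
    (not_X_dvd_mul_prod ha hu)
  have : x = t + u * (∏ i ∈ s, X i) * c :=
    mul_left_cancel₀ (X_ne_zero a) (by rw [← hxyz]; ring)
  rw [this]
  exact add_mem ht (Ideal.mul_mem_right _ _ (Ideal.mul_mem_left _ _ prod_mem_prodEraseIdeal))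

lemma extQuotientVanishes_prodEraseIdeal {J : Ideal (MvPolynomial σ K)} {k : ℕ}
    (H : ExtQuotientVanishes J ⊥ (k + 2)) (hu : ∀ a ∈ s, ¬ X a ∣ u) :
    ExtQuotientVanishes J (prodEraseIdeal u s) k := by
  induction s using Finset.induction_on with
  | empty => exact prodEraseIdeal_empty (u := u) ▸ .top
  | insert a s ha ih =>
    rw [Finset.forall_mem_insert] at hu
    refine (ih hu.2).of_colon (mul_mem_prodEraseIdeal_insert ha hu.1) ?_
    have hsup : prodEraseIdeal u (insert a s) ⊔ Ideal.span {X a} =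
        ⊥ ⊔ Ideal.span {X a} ⊔ Ideal.span {u * ∏ i ∈ s, X i} := by
      rw [prodEraseIdeal_insert ha, sup_right_comm, bot_sup_eq,
        sup_eq_right.2 (Ideal.mul_le_left : Ideal.span {X a} * prodEraseIdeal u s ≤ _)]
    rw [hsup]
    refine (H.sup_span_singleton fun x hx ↦ ?_).sup_span_singleton fun x hx ↦ ?_
    · simpa using! hx
    · rw [bot_sup_eq, Ideal.mem_span_singleton] at hx ⊢
      exact (X_prime.dvd_or_dvd hx).resolve_left (not_X_dvd_mul_prod ha hu.1)

/-- `S ⧸ I` has dimension at most `dim S - 2` for `I = prodEraseIdeal u s`. -/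
lemma ringKrullDim_quotient_prodEraseIdeal_add_two_le [Finite σ]
    (hu : ∀ a ∈ s, ¬ X a ∣ u) :
    ringKrullDim (MvPolynomial σ K ⧸ prodEraseIdeal u s) + 1 + 1 ≤ Nat.card σ := by
  set p : MvPolynomial σ K := ∏ i ∈ s, X i
  set g : MvPolynomial σ K := ∑ j ∈ s, u * ∏ i ∈ s.erase j, X i
  have hp : p ≠ 0 := Finset.prod_ne_zero_iff.2 fun i _ ↦ X_ne_zero i
  have hg : ∀ a ∈ s, ¬ X a ∣ g := fun a ha h ↦ by
    simp only [g, ← Finset.add_sum_erase s _ ha] at h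
    refine not_X_dvd_mul_prod (Finset.notMem_erase a s) (hu a ha)
      ((dvd_add_left (Finset.dvd_sum fun j hj ↦ ?_)).1 h)
    exact Dvd.dvd.mul_left (Finset.dvd_prod_of_mem _
      (Finset.mem_erase.2 ⟨(Finset.ne_of_mem_erase hj).symm, ha⟩)) _
  have hpg : ∀ x, p ∣ g * x → p ∣ x := fun x hx ↦ by
    refine Finset.prod_dvd_of_isRelPrime (fun i _ j _ hij ↦ ?_) fun i hi ↦
      (X_prime.dvd_or_dvd ((Finset.dvd_prod_of_mem _ hi).trans hx)).resolve_left (hg i hi)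
    exact X_prime.irreducible.isRelPrime_iff_not_dvd.2 fun h ↦ hij (X_dvd_X.1 h)
  have hle : Ideal.span {p} ≤ prodEraseIdeal u s :=
    (Ideal.span_singleton_le_iff_mem _).2 prod_mem_prodEraseIdeal
  have hgmem : g ∈ prodEraseIdeal u s :=
    sum_mem fun j hj ↦ mul_prod_erase_mem_prodEraseIdeal hj
  have h₁ : ringKrullDim (MvPolynomial σ K ⧸ prodEraseIdeal u s) + 1 ≤
      ringKrullDim (MvPolynomial σ K ⧸ Ideal.span {p}) := by
    refine ringKrullDim_succ_le_of_surjective (Ideal.Quotient.factor hle)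
      (Ideal.Quotient.factor_surjective hle) (r := Ideal.Quotient.mk _ g)
      (mem_nonZeroDivisors_iff_right.2 fun x hx ↦ ?_) ?_
    · obtain ⟨x, rfl⟩ := Ideal.Quotient.mk_surjective x
      rw [← map_mul, Ideal.Quotient.eq_zero_iff_mem, Ideal.mem_span_singleton, mul_comm] at hx
      rw [Ideal.Quotient.eq_zero_iff_mem, Ideal.mem_span_singleton]
      exact hpg x hx
    · simpa [Ideal.Quotient.eq_zero_iff_mem] using! hgmem
  have h₂ := ringKrullDim_quotient_succ_le_of_nonZeroDivisor (mem_nonZeroDivisors_of_ne_zero hp)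
  rw [ringKrullDim_of_isNoetherianRing, ringKrullDim_eq_zero_of_field, zero_add] at h₂
  exact (add_le_add_left h₁ 1).trans h₂

end prodEraseIdeal

lemma isSMulRegular_X_quotient_span_X_image (t : Set σ) {i : σ} (hi : i ∉ t) :
    IsSMulRegular (MvPolynomial σ K ⧸ Ideal.span (X '' t : Set (MvPolynomial σ K)))
      (X i : MvPolynomial σ K) := by
  refine (isSMulRegular_quotient_iff_mem_of_smul_mem _ _).2 fun x hx ↦ ?_
  rw [smul_eq_mul, mem_ideal_span_X_image] at hx
  refine mem_ideal_span_X_image.2 fun m hm ↦ ?_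
  obtain ⟨j, hj, hne⟩ := hx (Finsupp.single i 1 + m) <| by
    rwa [mem_support_iff, coeff_X_mul, ← mem_support_iff]
  refine ⟨j, hj, ?_⟩
  simpa [Finsupp.single_eq_of_ne (show j ≠ i by rintro rfl; exact hi hj)] using hne

variable (K) in
lemma isRegular_ofFn_X (n : ℕ) :
    RingTheory.Sequence.IsRegular (MvPolynomial (Fin n) K)
      (List.ofFn (X : Fin n → MvPolynomial (Fin n) K)) where
  regular_mod_prev i hi := by
    rw [List.length_ofFn] at hi
    have : Ideal.ofList ((List.ofFn (X : Fin n → MvPolynomial (Fin n) K)).take i) •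
        (⊤ : Submodule (MvPolynomial (Fin n) K) (MvPolynomial (Fin n) K)) =
        Ideal.span (X '' {j : Fin n | (j : ℕ) < i}) := by
      rw [smul_eq_mul, Ideal.mul_top, Ideal.ofList]
      congr 1
      ext x
      simp only [Set.mem_ofPred_eq, Set.mem_image, List.mem_take_iff_getElem, List.getElem_ofFn,
        List.length_ofFn]
      constructor
      · rintro ⟨j, hj, rfl⟩
        exact ⟨⟨j, by omega⟩, by simp; omega, rfl⟩
      · rintro ⟨j, hj, rfl⟩
        exact ⟨j, by omega, rfl⟩
    rw [this, List.getElem_ofFn]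
    exact isSMulRegular_X_quotient_span_X_image _ (by simp)
  top_ne_smul := by
    rw [smul_eq_mul, Ideal.mul_top]
    refine ((Ideal.span_mono fun x hx ↦ ?_).trans_lt span_range_X_ne_top.lt_top).ne'
    simpa using hx

end MvPolynomial

lemma MvPolynomial.idealDepth_prodEraseIdeal {K : Type*} [Field K] (n : ℕ)
    {u : MvPolynomial (Fin n) K} {s : Finset (Fin n)} (hs : s.Nonempty)
    (hu : ∀ a ∈ s, ¬ X a ∣ u)
    (huJ : u ∈ Ideal.span (Set.range (X : Fin n → MvPolynomial (Fin n) K))) (hn : 2 ≤ n) :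
    idealDepth (Ideal.span (Set.range (X : Fin n → MvPolynomial (Fin n) K)))
      (MvPolynomial (Fin n) K ⧸ prodEraseIdeal u s) = n - 2 := by
  refine IsGreatest.csSup_eq ⟨?_, ?_⟩
  · have H := ExtQuotientVanishes.of_isRegular span_range_X_ne_top
      (fun r hr ↦ Ideal.subset_span (by simpa using hr)) (isRegular_ofFn_X K n)
    rw [List.length_ofFn] at H
    have H' := extQuotientVanishes_prodEraseIdeal (k := n - 2) (by rwa [Nat.sub_add_cancel hn]) hu
    refine H'.exists_isRegular span_range_X_ne_top (Ideal.span_le.2 ?_)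
    rintro _ (rfl | ⟨j, -, rfl⟩)
    · obtain ⟨a, ha⟩ := hs
      exact Ideal.mem_of_dvd _ (Finset.dvd_prod_of_mem _ ha) (Ideal.subset_span ⟨a, rfl⟩)
    · exact Ideal.mul_mem_right _ _ huJ
  · rintro _ ⟨rs, rfl, -, reg⟩
    have h₁ := reg.length_le_supportDim
    rw [Module.supportDim_quotient_eq_ringKrullDim] at h₁
    have h₂ := (add_le_add_left (add_le_add_left h₁ 1) 1).trans
      (ringKrullDim_quotient_prodEraseIdeal_add_two_le hu)
    rw [Nat.card_fin] at h₂
    have h₃ : rs.length + 1 + 1 ≤ n := by exact_mod_cast h₂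
    omega

/-- Let `n ≥ 4`, `S = K[x₁,…,xₙ]` (with `x_k = X ⟨k-1⟩`) and let `Tₙ` be
the ideal generated by `x₄⋯xₙ` together with the monomials `x₁x₂x₃·(x₄⋯xₙ)/xⱼ` for
`j = 4, …, n`.  Then `depth S/Tₙ = n - 2`. -/
theorem depth_Tn {K : Type*} [Field K] (n : ℕ) (hn : 4 ≤ n) :
    idealDepth (Ideal.span (Set.range (X : Fin n → MvPolynomial (Fin n) K)))
      (MvPolynomial (Fin n) K ⧸
        Ideal.span
          ({∏ i ∈ Finset.univ.filter (fun i : Fin n => 3 ≤ (i : ℕ)),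
              (X i : MvPolynomial (Fin n) K)} ∪
            (fun j : Fin n =>
              (X (⟨0, by omega⟩ : Fin n) : MvPolynomial (Fin n) K) * X ⟨1, by omega⟩ *
                X ⟨2, by omega⟩ *
                ∏ i ∈ Finset.univ.filter (fun i : Fin n => 3 ≤ (i : ℕ) ∧ i ≠ j), X i) ''
              {j : Fin n | 3 ≤ (j : ℕ)})) = n - 2 := by
  set s : Finset (Fin n) := Finset.univ.filter fun i ↦ 3 ≤ (i : ℕ) with hs
  have herase : (fun j : Fin n ↦ (X ⟨0, by omega⟩ : MvPolynomial (Fin n) K) * X ⟨1, by omega⟩ *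
      X ⟨2, by omega⟩ * ∏ i ∈ Finset.univ.filter (fun i : Fin n ↦ 3 ≤ (i : ℕ) ∧ i ≠ j), X i) =
      fun j ↦ X ⟨0, by omega⟩ * X ⟨1, by omega⟩ * X ⟨2, by omega⟩ * ∏ i ∈ s.erase j, X i := by
    refine funext fun j ↦ congrArg _ (Finset.prod_congr ?_ fun _ _ ↦ rfl)
    ext i
    simp [hs, and_comm]
  have hcoe : {j : Fin n | 3 ≤ (j : ℕ)} = s := by simp [hs]
  rw [herase, hcoe]
  refine idealDepth_prodEraseIdeal n ⟨⟨3, by omega⟩, by simp [hs]⟩ (fun a ha h ↦ ?_)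
    (Ideal.mul_mem_left _ _ (Ideal.subset_span ⟨_, rfl⟩)) (by omega)
  have ha : 3 ≤ (a : ℕ) := by simpa [hs] using ha
  simp only [X_prime.dvd_mul, X_dvd_X, Fin.ext_iff] at h
  omega
end
end

section
/- Let 𝔗 be the 3-uniform clutter on [5] with circuits {1,2,4}, {1,3,4}, {2,3,4}, {1,2,5}, {1,3,5}, {2,3,5} (the faces of the triangular bipyramid with apexes 4 and 5 over the triangle {1,2,3}), so that 𝔗̄ = {{1,2,3},{1,4,5},{2,4,5},{3,4,5}}. Then the circuit ideal I(𝔗̄) = (x_1x_2x_3, x_1x_4x_5, x_2x_4x_5, x_3x_4x_5) ⊆ K[x_1,…,x_5] does not have a 3-linear resolution. -/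
open MvPolynomial

noncomputable section

/-- A cubic form in the ideal is a scalar multiple of `x₁x₂x₃` plus a multiple of `x₄x₅`. -/
lemma exists_eq_of_mem_of_isHomogeneous {K : Type*} [Field K] {f : MvPolynomial (Fin 5) K}
    (hf : f ∈ Ideal.span
        {(X 0 : MvPolynomial (Fin 5) K) * X 1 * X 2,
         (X 0 : MvPolynomial (Fin 5) K) * X 3 * X 4,
         (X 1 : MvPolynomial (Fin 5) K) * X 3 * X 4,
         (X 2 : MvPolynomial (Fin 5) K) * X 3 * X 4})
    (hd : f.IsHomogeneous 3) :
    ∃ (c : K) (q : MvPolynomial (Fin 5) K), f = X 0 * X 1 * X 2 * C c + X 3 * X 4 * q := by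
  obtain ⟨p, q, hpq⟩ : ∃ p q, f = X 0 * X 1 * X 2 * p + X 3 * X 4 * q := by
    simp only [Ideal.mem_span_insert, Ideal.mem_span_singleton] at hf
    obtain ⟨p, -, ⟨a, -, ⟨b, -, ⟨c, rfl⟩, rfl⟩, rfl⟩, rfl⟩ := hf
    exact ⟨p, a * X 0 + b * X 1 + c * X 2, by ring⟩
  have habc : (X 0 * X 1 * X 2 : MvPolynomial (Fin 5) K) ∈ homogeneousSubmodule (Fin 5) K 3 :=
    ((isHomogeneous_X K 0).mul (isHomogeneous_X K 1)).mul (isHomogeneous_X K 2)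
  have hde : (X 3 * X 4 : MvPolynomial (Fin 5) K) ∈ homogeneousSubmodule (Fin 5) K 2 :=
    (isHomogeneous_X K 3).mul (isHomogeneous_X K 4)
  refine ⟨coeff 0 p, homogeneousComponent 1 q, ?_⟩
  let := gradedAlgebra (σ := Fin 5) (R := K)
  have h1 := DirectSum.coe_decompose_mul_of_left_mem_of_le (homogeneousSubmodule (Fin 5) K)
    (b := p) habc le_rfl
  have h2 := DirectSum.coe_decompose_mul_of_left_mem_of_le (homogeneousSubmodule (Fin 5) K)
    (b := q) (n := 3) hde (by norm_num)
  have hdec (g : MvPolynomial (Fin 5) K) (i : ℕ) :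
      (DirectSum.decompose (homogeneousSubmodule (Fin 5) K) g i : MvPolynomial (Fin 5) K) =
        homogeneousComponent i g := decomposition.decompose'_apply g i
  simp only [hdec, tsub_self, homogeneousComponent_zero] at h1 h2
  calc f = homogeneousComponent 3 f := by rw [homogeneousComponent_of_mem hd, if_pos rfl]
    _ = _ := by rw [hpq, map_add, h1, h2]

/-- If `x₁x₂x₃ L + x₄x₅ Q = g`, then the coefficients of `L` at monomials not divisible by `x₄x₅`
are coefficients of `g`. -/
lemma coeff_eq_of_add_eq {K : Type*} [Field K] {L Q g : MvPolynomial (Fin 5) K}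
    (h : X 0 * X 1 * X 2 * L + X 3 * X 4 * Q = g) {m : Fin 5 →₀ ℕ} (hm : m 3 = 0 ∨ m 4 = 0) :
    coeff m L = coeff (.single 0 1 + .single 1 1 + .single 2 1 + m) g := by
  have h0 : (X 0 * X 1 * X 2 : MvPolynomial (Fin 5) K) =
      monomial (.single 0 1 + .single 1 1 + .single 2 1) 1 := by simp [X, monomial_mul]
  have h3 : (X 3 * X 4 : MvPolynomial (Fin 5) K) =
      monomial (.single 3 1 + .single 4 1) 1 := by simp [X, monomial_mul]
  rw [← h, h0, h3, coeff_add, coeff_monomial_mul, coeff_monomial_mul', if_neg]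
  · simp
  · intro hle
    have e3 := hle 3
    have e4 := hle 4
    simp at e3 e4
    omega

/-- Let `𝔗` be the 3-uniform clutter on `[5]` given by the faces of the
triangular bipyramid with apexes `4, 5` over the triangle `{1,2,3}` (vertices `1,…,5`
realized as `0,…,4 : Fin 5`), so `𝔗̄ = {{1,2,3},{1,4,5},{2,4,5},{3,4,5}}`.  Then the
circuit ideal `I(𝔗̄) = (x₁x₂x₃, x₁x₄x₅, x₂x₄x₅, x₃x₄x₅)` does not have a 3-linear
resolution. -/
theorem bipyramid_not_linear {K : Type*} [Field K] :
    ¬ HasLinearResolution 3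
      (Ideal.span
        {(X 0 : MvPolynomial (Fin 5) K) * X 1 * X 2,
         (X 0 : MvPolynomial (Fin 5) K) * X 3 * X 4,
         (X 1 : MvPolynomial (Fin 5) K) * X 3 * X 4,
         (X 2 : MvPolynomial (Fin 5) K) * X 3 * X 4}) := by
  rintro ⟨b, deg, aug, d, ⟨hrange, haug, hd, hker, -⟩, hdeg⟩
  have hform : ∀ k, ∃ (c : K) (q : MvPolynomial (Fin 5) K),
      aug (Pi.single k 1) = X 0 * X 1 * X 2 * C c + X 3 * X 4 * q := fun k ↦
    exists_eq_of_mem_of_isHomogeneous (hrange ▸ LinearMap.mem_range_self aug _)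
      (by simpa [hdeg] using haug k)
  choose c q hcq using hform
  let Λ := Fintype.linearCombination (MvPolynomial (Fin 5) K)
    fun k ↦ (C (c k) : MvPolynomial (Fin 5) K)
  let Q := Fintype.linearCombination (MvPolynomial (Fin 5) K) q
  have hsplit (v) : X 0 * X 1 * X 2 * Λ v + X 3 * X 4 * Q v = aug v := by
    rw [LinearMap.pi_apply_eq_sum_univ aug v]
    simp only [Λ, Q, Fintype.linearCombination_apply, smul_eq_mul, Finset.mul_sum, ← Finset.sum_add_distrib]
    refine Finset.sum_congr rfl fun k _ ↦ ?_
    have : (fun j ↦ if k = j then (1 : MvPolynomial (Fin 5) K) else 0) = Pi.single k 1 := by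
      ext1 j; simp [Pi.single_apply, eq_comm]
    rw [this, hcq]
    ring
  have hΛgen (k) : Λ (d 0 (Pi.single k 1)) = 0 := by
    have hlin : (Λ (d 0 (Pi.single k 1))).IsHomogeneous 1 := by
      simp only [Λ, Fintype.linearCombination_apply, smul_eq_mul]
      refine IsHomogeneous.sum _ _ _ fun l _ ↦ ?_
      rcases hd 0 k l with h | ⟨e, he, h⟩
      · simpa [h] using isHomogeneous_zero _ _ _
      · obtain rfl : e = 1 := by simp only [hdeg] at he; omega
        simpa using h.mul (isHomogeneous_C _ (c l))
    have hzero : aug (d 0 (Pi.single k 1)) = 0 :=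
      LinearMap.mem_ker.1 (hker ▸ LinearMap.mem_range_self (d 0) _)
    ext m
    by_contra hm
    have hm1 : m.degree = 1 := by
      rw [Finsupp.degree_eq_weight_one]
      exact hlin hm
    rw [coeff_zero, coeff_eq_of_add_eq (hsplit _), hzero, coeff_zero] at hm
    · exact hm rfl
    · have : m 3 + m 4 ≤ m.degree := by
        rw [Finsupp.degree_eq_sum, Fin.sum_univ_five]; omega
      omega
  have hΛ (v) (hv : aug v = 0) : Λ v = 0 := by
    obtain ⟨w, rfl⟩ : v ∈ LinearMap.range (d 0) := hker ▸ LinearMap.mem_ker.2 hv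
    have : Λ ∘ₗ d 0 = 0 := by
      refine LinearMap.pi_ext' fun k ↦ ?_
      exact LinearMap.ext_ring (hΛgen k)
    exact LinearMap.congr_fun this w
  have hsurj {f} (hf : f ∈ _) : ∃ v, aug v = f := LinearMap.mem_range.1 (hrange ▸ hf)
  obtain ⟨v, hv⟩ := hsurj (Ideal.subset_span (Set.mem_insert _ _))
  obtain ⟨w, hw⟩ := hsurj (Ideal.subset_span (Set.mem_insert_of_mem _ (Set.mem_insert _ _)))
  have hvw : X 3 * X 4 * Λ v = X 1 * X 2 * Λ w := by
    have := hΛ ((X 3 * X 4 : MvPolynomial (Fin 5) K) • v -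
      (X 1 * X 2 : MvPolynomial (Fin 5) K) • w) (by
        simp only [map_sub, map_smul, hv, hw, smul_eq_mul]; ring)
    simpa [sub_eq_zero] using this
  have hone : coeff 0 (Λ v) = 1 := by
    rw [coeff_eq_of_add_eq ((hsplit v).trans hv) (by simp)]
    simp [X, monomial_mul]
  have h := congr_arg (coeff (.single 3 1 + .single 4 1)) hvw
  have h3 : (X 3 * X 4 : MvPolynomial (Fin 5) K) =
      monomial (.single 3 1 + .single 4 1) 1 := by simp [X, monomial_mul]
  have h1 : (X 1 * X 2 : MvPolynomial (Fin 5) K) =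
      monomial (.single 1 1 + .single 2 1) 1 := by simp [X, monomial_mul]
  rw [h3, h1, coeff_monomial_mul', coeff_monomial_mul', if_pos le_rfl, tsub_self, hone,
    if_neg fun hle ↦ by simpa using hle 1] at h
  simp at h
end
end
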